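/- For a ∈ (0,a*) let u_a be a minimizer of e(a) and ε_a = (∫_{ℝ²}|∇|u_a||² dx)^{−1/2}. Then as a ↗ a*: ε_a² ∫_{ℝ²}|u_a|⁴ dx → 2, ε_a² ∫_{ℝ²} V_Ω(x)|u_a|² dx → 0, ε_a² ∫_{ℝ²}∫_{ℝ²} ln(1+|x−y|)|u_a(x)|²|u_a(y)|² dx dy → 0, and ε_a² e(a) → 0. -/

import Mathlib

open MeasureTheory Filter Topology Set Metric

noncomputable section

/-- The plane `ℝ²` with the Euclidean norm. -/
abbrev Plane : Type := EuclideanSpace ℝ (Fin 2)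

def e0 : Plane := EuclideanSpace.single (0 : Fin 2) (1 : ℝ)
def e1 : Plane := EuclideanSpace.single (1 : Fin 2) (1 : ℝ)

/-- Partial derivatives of a complex-valued function. -/
def d0 (u : Plane → ℂ) (x : Plane) : ℂ := fderiv ℝ u x e0
def d1 (u : Plane → ℂ) (x : Plane) : ℂ := fderiv ℝ u x e1

/-- `|∇u|²` for complex-valued `u`. -/
def gradSq (u : Plane → ℂ) (x : Plane) : ℝ := ‖d0 u x‖ ^ 2 + ‖d1 u x‖ ^ 2

/-- `|∇|u||²`. -/
def gradAbsSq (u : Plane → ℂ) (x : Plane) : ℝ := ‖fderiv ℝ (fun y => ‖u y‖) x‖ ^ 2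

/-- Membership in `H¹(ℝ², ℂ)` (smooth-representative formulation). -/
def InH1 (u : Plane → ℂ) : Prop :=
  Differentiable ℝ u ∧ Integrable (fun x => ‖u x‖ ^ 2) ∧ Integrable (gradSq u)

/-- Membership in the space `𝓗 = {u ∈ H¹ : ∫ V |u|² < ∞}`. -/
def InH (V : Plane → ℝ) (u : Plane → ℂ) : Prop :=
  InH1 u ∧ Integrable (fun x => V x * ‖u x‖ ^ 2)

/-- The constraint set `S_a`. -/
def Sset (V : Plane → ℝ) (a : ℝ) : Set (Plane → ℂ) :=
  {u | InH V u ∧ (∫ x : Plane, ‖u x‖ ^ 2) = a}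

/-- The momentum density `x^⊥ · (iu, ∇u)`, with `x^⊥ = (-x₂, x₁)` and
`(iu,∇u)_j = Im(ū ∂_j u)`. -/
def momentum (u : Plane → ℂ) (x : Plane) : ℝ :=
  (-(x 1)) * ((starRingEnd ℂ) (u x) * d0 u x).im + (x 0) * ((starRingEnd ℂ) (u x) * d1 u x).im

/-- The logarithmic convolution term `∫∫ ln|x-y| |u(x)|²|u(y)|²`. -/
def logConv (u : Plane → ℂ) : ℝ :=
  ∫ x : Plane, ∫ y : Plane, Real.log ‖x - y‖ * ‖u x‖ ^ 2 * ‖u y‖ ^ 2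

/-- The energy functional `E_a`. -/
def Ea (V : Plane → ℝ) (Ω : ℝ) (u : Plane → ℂ) : ℝ :=
  (∫ x : Plane, (gradSq u x + V x * ‖u x‖ ^ 2)) + (1 / 2) * logConv u
    - (1 / 2) * (∫ x : Plane, ‖u x‖ ^ 4) - Ω * (∫ x : Plane, momentum u x)

/-- `u` is a minimizer of `e(a) = inf_{S_a} E_a`. -/
def IsMinimizer (V : Plane → ℝ) (Ω a : ℝ) (u : Plane → ℂ) : Prop :=
  u ∈ Sset V a ∧ ∀ v ∈ Sset V a, Ea V Ω u ≤ Ea V Ω v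

/-- `e(a) = inf_{u ∈ S_a} E_a(u)`. -/
def eInf (V : Plane → ℝ) (Ω a : ℝ) : ℝ := sInf (Ea V Ω '' Sset V a)

/-- `f(x) → ∞` as `|x| → ∞`. -/
def TendsInfty (f : Plane → ℝ) : Prop := ∀ M : ℝ, ∃ R : ℝ, ∀ x : Plane, R ≤ ‖x‖ → M ≤ f x

/-- Hypotheses (1.10): `0 ≤ V ∈ L^∞_loc` and `liminf_{|x|→∞} V(x)/|x|² > 0`. -/
def V110 (V : Plane → ℝ) : Prop :=
  Measurable V ∧ (∀ x, 0 ≤ V x) ∧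
  (∀ R : ℝ, ∃ C : ℝ, ∀ x : Plane, ‖x‖ ≤ R → V x ≤ C) ∧
  (∃ c : ℝ, 0 < c ∧ ∃ R : ℝ, ∀ x : Plane, R ≤ ‖x‖ → c * ‖x‖ ^ 2 ≤ V x)

/-- The set of rotational velocities `W > 0` with `V(x) - (W²/4)|x|² → ∞`;
`Ω* = sup RotSet V`. -/
def RotSet (V : Plane → ℝ) : Set ℝ :=
  {W : ℝ | 0 < W ∧ TendsInfty (fun x => V x - W ^ 2 / 4 * ‖x‖ ^ 2)}

/-- `Ω < Ω*` where `Ω* = sup RotSet V` (possibly `+∞`). -/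
def SubCritical (V : Plane → ℝ) (Ω : ℝ) : Prop := ∃ W ∈ RotSet V, Ω < W

def d0R (q : Plane → ℝ) (x : Plane) : ℝ := fderiv ℝ q x e0
def d1R (q : Plane → ℝ) (x : Plane) : ℝ := fderiv ℝ q x e1

/-- `|∇q|²` for real-valued `q`. -/
def gradSqR (q : Plane → ℝ) (x : Plane) : ℝ := (d0R q x) ^ 2 + (d1R q x) ^ 2

/-- The Laplacian of a real-valued function. -/
def lapR (q : Plane → ℝ) (x : Plane) : ℝ := fderiv ℝ (d0R q) x e0 + fderiv ℝ (d1R q) x e1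

/-- `Q` is the positive radially symmetric `H¹` solution of `-ΔQ + Q - Q³ = 0` on `ℝ²`. -/
def IsGroundState (Q : Plane → ℝ) : Prop :=
  ContDiff ℝ 2 Q ∧ (∀ x, 0 < Q x) ∧ (∀ x y : Plane, ‖x‖ = ‖y‖ → Q x = Q y) ∧
  Integrable (fun x => (Q x) ^ 2) ∧ Integrable (fun x => ‖fderiv ℝ Q x‖ ^ 2) ∧
  (∀ x, - lapR Q x + Q x - (Q x) ^ 3 = 0)

/-- The Laplacian of a complex-valued function. -/
def lapC (u : Plane → ℂ) (x : Plane) : ℂ := fderiv ℝ (d0 u) x e0 + fderiv ℝ (d1 u) x e1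

/-- The Euler–Lagrange equation (1.18):
`-Δu + V u + (∫ ln|x-y||u(y)|² dy) u + iΩ (x^⊥·∇u) = μ u + |u|² u`. -/
def EulerLagrange (V : Plane → ℝ) (Ω : ℝ) (u : Plane → ℂ) (μ : ℝ) : Prop :=
  ∀ x : Plane,
    - lapC u x + (V x : ℂ) * u x
      + (((∫ y : Plane, Real.log ‖x - y‖ * ‖u y‖ ^ 2) : ℝ) : ℂ) * u x
      + Complex.I * (Ω : ℂ) * (((-(x 1) : ℝ) : ℂ) * d0 u x + ((x 0 : ℝ) : ℂ) * d1 u x)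
    = (μ : ℂ) * u x + ((‖u x‖ ^ 2 : ℝ) : ℂ) * u x

/-- Condition (V): `0 ≤ V_Ω ∈ C^α_loc`, `V_Ω` vanishes only at the origin, and `V` has at
most exponential growth. Here `V_Ω(x) = V(x) - (Ω²/4)|x|²`. -/
def CondV (V : Plane → ℝ) (Ω α : ℝ) : Prop :=
  α ∈ Ioo (0 : ℝ) 1 ∧
  (∀ x : Plane, 0 ≤ V x - Ω ^ 2 / 4 * ‖x‖ ^ 2) ∧
  (∀ x : Plane, V x - Ω ^ 2 / 4 * ‖x‖ ^ 2 = 0 ↔ x = 0) ∧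
  (∀ R : ℝ, 0 < R → ∃ C : ℝ, ∀ x ∈ closedBall (0 : Plane) R, ∀ y ∈ closedBall (0 : Plane) R,
    |(V x - Ω ^ 2 / 4 * ‖x‖ ^ 2) - (V y - Ω ^ 2 / 4 * ‖y‖ ^ 2)| ≤ C * ‖x - y‖ ^ α) ∧
  (∃ C γ : ℝ, 0 < γ ∧ ∀ x : Plane, V x ≤ C * Real.exp (γ * ‖x‖))

/-- `ε_a = (∫ |∇|u_a||²)^{-1/2}` for a family of minimizers. -/
def epsOf (u : ℝ → Plane → ℂ) (a : ℝ) : ℝ :=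
  (∫ x : Plane, gradAbsSq (u a) x) ^ (-(1 : ℝ) / 2)

/-- The rescaled family
`w_a(y) = ε_a u_a(ε_a y + x_a) e^{-i((ε_a Ω/2) y·x_a^⊥ - θ)}`. -/
def wfam (Ω : ℝ) (u : ℝ → Plane → ℂ) (xa : ℝ → Plane) (a θv : ℝ) (y : Plane) : ℂ :=
  ((epsOf u a : ℝ) : ℂ) * u a ((epsOf u a) • y + xa a) *
    Complex.exp (-Complex.I *
      ((((epsOf u a * Ω / 2) * (-(y 0) * (xa a 1) + (y 1) * (xa a 0)) - θv) : ℝ) : ℂ))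

/-- The limit profile `(1/√a*) Q(x/√a*)` where `a* = ‖Q‖₂²`. -/
def Qstar (Q : Plane → ℝ) (x : Plane) : ℝ :=
  (Real.sqrt (∫ y : Plane, (Q y) ^ 2))⁻¹ * Q ((Real.sqrt (∫ y : Plane, (Q y) ^ 2))⁻¹ • x)

/-- A nonnegative integrable function on the line is bounded by the `L¹` norm of its derivative. -/
theorem le_integral_abs_deriv {f f' : ℝ → ℝ} (hd : ∀ s, HasDerivAt f (f' s) s)
    (hf : Integrable f) (hf' : Integrable f') (s : ℝ) : f s ≤ ∫ t, |f' t| := by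
  have h0 : Tendsto f atBot (𝓝 0) :=
    tendsto_zero_of_hasDerivAt_of_integrableOn_Iic (a := s) (fun x _ => hd x)
      hf'.integrableOn hf.integrableOn
  have h1 := integral_Iic_of_hasDerivAt_of_tendsto' (a := s) (fun x _ => hd x)
    hf'.integrableOn h0
  rw [sub_zero] at h1
  rw [← h1]
  calc ∫ x in Iic s, f' x ≤ ∫ x in Iic s, |f' x| :=
        setIntegral_mono hf'.integrableOn hf'.abs.integrableOn (fun x => le_abs_self _)
    _ ≤ ∫ x, |f' x| := setIntegral_le_integral hf'.abs (ae_of_all _ fun x => abs_nonneg _)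

theorem integrable_sq_of_partial_derivs {f f0 f1 : ℝ × ℝ → ℝ}
    (h0 : ∀ s t, HasDerivAt (fun r => f (r, t)) (f0 (s, t)) s)
    (h1 : ∀ s t, HasDerivAt (fun r => f (s, r)) (f1 (s, t)) t)
    (hpos : ∀ p, 0 ≤ f p) (hf : Integrable f) (hf0 : Integrable f0) (hf1 : Integrable f1) :
    Integrable (fun p => f p ^ 2) ∧ ∫ p, f p ^ 2 ≤ (∫ p, |f0 p|) * ∫ p, |f1 p| := by
  have hA : ∀ᵐ p : ℝ × ℝ, f p ≤ ∫ r, |f0 (r, p.2)| := by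
    have : ∀ᵐ t : ℝ, ∀ s, f (s, t) ≤ ∫ r, |f0 (r, t)| := by
      filter_upwards [hf.prod_left_ae, hf0.prod_left_ae] with t ht ht0 s
      exact le_integral_abs_deriv (fun s => h0 s t) ht ht0 s
    filter_upwards [Measure.quasiMeasurePreserving_snd.ae this] with p hp
    exact hp p.1
  have hB : ∀ᵐ p : ℝ × ℝ, f p ≤ ∫ r, |f1 (p.1, r)| := by
    have : ∀ᵐ s : ℝ, ∀ t, f (s, t) ≤ ∫ r, |f1 (s, r)| := by
      filter_upwards [hf.prod_right_ae, hf1.prod_right_ae] with s hs hs1 t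
      exact le_integral_abs_deriv (fun t => h1 s t) hs hs1 t
    filter_upwards [Measure.quasiMeasurePreserving_fst.ae this] with p hp
    exact hp p.2
  have hdom : Integrable (fun p : ℝ × ℝ => (∫ r, |f1 (p.1, r)|) * ∫ r, |f0 (r, p.2)|) :=
    Integrable.mul_prod (f := fun s => ∫ r, |f1 (s, r)|) (g := fun t => ∫ r, |f0 (r, t)|)
      hf1.abs.integral_prod_left hf0.abs.integral_prod_right
  have hle : ∀ᵐ p : ℝ × ℝ, f p ^ 2 ≤ (∫ r, |f1 (p.1, r)|) * ∫ r, |f0 (r, p.2)| := by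
    filter_upwards [hA, hB] with p ha hb
    rw [sq]
    exact mul_le_mul hb ha (hpos p) (integral_nonneg fun r => abs_nonneg _)
  have hint : Integrable (fun p => f p ^ 2) := by
    refine hdom.mono' (hf.aestronglyMeasurable.pow 2) ?_
    filter_upwards [hle] with p hp
    rwa [Real.norm_of_nonneg (sq_nonneg _)]
  refine ⟨hint, (integral_mono_ae hint hdom hle).trans_eq ?_⟩
  have := integral_prod_mul (μ := (volume : Measure ℝ)) (ν := (volume : Measure ℝ))
    (fun s => ∫ r, |f1 (s, r)|) (fun t => ∫ r, |f0 (r, t)|)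
  rw [Measure.volume_eq_prod, this, mul_comm]
  congr 1
  · rw [integral_prod_symm _ hf0.abs]
  · rw [integral_prod _ hf1.abs]

/-- The measurable identification of `ℝ × ℝ` with the plane. -/
def planeEquiv : ℝ × ℝ ≃ᵐ Plane :=
  MeasurableEquiv.finTwoArrow.symm.trans (MeasurableEquiv.toLp 2 (Fin 2 → ℝ))

theorem planeEquiv_apply (p : ℝ × ℝ) : planeEquiv p = p.1 • e0 + p.2 • e1 := by
  ext i
  fin_cases i <;> simp [planeEquiv, e0, e1, MeasurableEquiv.finTwoArrow,
    MeasurableEquiv.piFinTwo]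

theorem measurePreserving_planeEquiv : MeasurePreserving planeEquiv volume volume :=
  (PiLp.volume_preserving_toLp (Fin 2)).comp ((volume_preserving_finTwoArrow ℝ).symm _)

theorem integrable_sq_of_fderiv {f : Plane → ℝ} (hf : Differentiable ℝ f) (hpos : ∀ x, 0 ≤ f x)
    (hfi : Integrable f) (h0 : Integrable fun x => fderiv ℝ f x e0)
    (h1 : Integrable fun x => fderiv ℝ f x e1) :
    Integrable (fun x => f x ^ 2) ∧
      ∫ x, f x ^ 2 ≤ (∫ x, |fderiv ℝ f x e0|) * ∫ x, |fderiv ℝ f x e1| := by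
  have hmp := measurePreserving_planeEquiv
  have emb := planeEquiv.measurableEmbedding
  have key := integrable_sq_of_partial_derivs (f := f ∘ planeEquiv)
    (f0 := (fun x => fderiv ℝ f x e0) ∘ planeEquiv) (f1 := (fun x => fderiv ℝ f x e1) ∘ planeEquiv)
    (fun s t => by
      have hd : HasDerivAt (fun r : ℝ => r • e0 + t • e1) e0 s := by
        simpa using ((hasDerivAt_id s).smul_const e0).add_const (t • e1)
      have := (hf (s • e0 + t • e1)).hasFDerivAt.comp_hasDerivAt s hd
      simpa [Function.comp_def, planeEquiv_apply] using this)
    (fun s t => by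
      have hd : HasDerivAt (fun r : ℝ => s • e0 + r • e1) e1 t := by
        simpa using ((hasDerivAt_id t).smul_const e1).const_add (s • e0)
      have := (hf (s • e0 + t • e1)).hasFDerivAt.comp_hasDerivAt t hd
      simpa [Function.comp_def, planeEquiv_apply] using this)
    (fun p => hpos _) ((hmp.integrable_comp_emb emb).2 hfi)
    ((hmp.integrable_comp_emb emb).2 h0) ((hmp.integrable_comp_emb emb).2 h1)
  have e1' := hmp.integral_comp' (fun x => f x ^ 2)
  have e2' := hmp.integral_comp' (fun x => |fderiv ℝ f x e0|)
  have e3' := hmp.integral_comp' (fun x => |fderiv ℝ f x e1|)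
  refine ⟨(hmp.integrable_comp_emb emb).1 key.1, ?_⟩
  rw [← e1', ← e2', ← e3']
  exact key.2

theorem fderiv_norm_sq_comp_apply {u : Plane → ℂ} (hu : Differentiable ℝ u) (x v : Plane) :
    fderiv ℝ (fun y => ‖u y‖ ^ 2) x v = 2 * inner ℝ (u x) (fderiv ℝ u x v) := by
  rw [((hu x).hasFDerivAt.norm_sq).fderiv]
  simp [mul_add]

theorem measurable_d0 (u : Plane → ℂ) : Measurable (d0 u) := measurable_fderiv_apply_const ℝ u e0

theorem measurable_d1 (u : Plane → ℂ) : Measurable (d1 u) := measurable_fderiv_apply_const ℝ u e1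

theorem abs_two_mul_inner_le (z w : ℂ) : |2 * inner ℝ z w| ≤ ‖z‖ ^ 2 + ‖w‖ ^ 2 := by
  have h := abs_real_inner_le_norm z w
  rw [abs_mul, abs_two]
  nlinarith [sq_nonneg (‖z‖ - ‖w‖)]

/-- Ladyzhenskaya's inequality. -/
theorem InH1.integrable_pow_four {u : Plane → ℂ} (hu : InH1 u) :
    Integrable (fun x => ‖u x‖ ^ 4) ∧
      ∫ x, ‖u x‖ ^ 4 ≤ (∫ x, (‖u x‖ ^ 2 + gradSq u x)) ^ 2 := by
  obtain ⟨hd, h2, hg⟩ := hu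
  have hdf : Differentiable ℝ (fun x => ‖u x‖ ^ 2) := hd.norm_sq ℝ
  have b0 : ∀ x, |fderiv ℝ (fun y => ‖u y‖ ^ 2) x e0| ≤ ‖u x‖ ^ 2 + gradSq u x := fun x => by
    rw [fderiv_norm_sq_comp_apply hd]
    refine (abs_two_mul_inner_le _ _).trans ?_
    have : 0 ≤ ‖d1 u x‖ ^ 2 := sq_nonneg _
    simp only [gradSq, d0] at *
    linarith
  have b1 : ∀ x, |fderiv ℝ (fun y => ‖u y‖ ^ 2) x e1| ≤ ‖u x‖ ^ 2 + gradSq u x := fun x => by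
    rw [fderiv_norm_sq_comp_apply hd]
    refine (abs_two_mul_inner_le _ _).trans ?_
    have : 0 ≤ ‖d0 u x‖ ^ 2 := sq_nonneg _
    simp only [gradSq, d1] at *
    linarith
  have hi := h2.add hg
  have i0 : Integrable fun x => fderiv ℝ (fun y => ‖u y‖ ^ 2) x e0 :=
    hi.mono' (measurable_fderiv_apply_const ℝ _ e0).aestronglyMeasurable (ae_of_all _ b0)
  have i1 : Integrable fun x => fderiv ℝ (fun y => ‖u y‖ ^ 2) x e1 :=
    hi.mono' (measurable_fderiv_apply_const ℝ _ e1).aestronglyMeasurable (ae_of_all _ b1)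
  have key := integrable_sq_of_fderiv hdf (fun x => sq_nonneg _) h2 i0 i1
  have e4 : (fun x => (‖u x‖ ^ 2) ^ 2) = fun x => ‖u x‖ ^ 4 := by
    funext x; ring
  rw [e4] at key
  refine ⟨key.1, key.2.trans ?_⟩
  rw [sq]
  exact mul_le_mul (integral_mono i0.abs hi b0) (integral_mono i1.abs hi b1)
    (integral_nonneg fun _ => abs_nonneg _)
    (integral_nonneg fun x => add_nonneg (sq_nonneg _) (add_nonneg (sq_nonneg _) (sq_nonneg _)))

/-- A locally integrable majorant of the squared logarithmic singularity. -/
def singKernel (z : Plane) : ℝ := if ‖z‖ < 1 then ‖z‖⁻¹ else 0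

theorem singKernel_nonneg (z : Plane) : 0 ≤ singKernel z := by
  unfold singKernel
  split_ifs <;> positivity

theorem integrable_singKernel : Integrable singKernel := by
  have h := (integrable_fun_norm_addHaar (volume : Measure Plane)
    (f := fun r : ℝ => if r < 1 then r⁻¹ else 0)).2 ?_
  · exact h
  · have : IntegrableOn (fun r : ℝ => (Iio (1 : ℝ)).indicator (fun _ => (1 : ℝ)) r) (Ioi 0) := by
      have h1 : IntegrableOn (fun _ : ℝ => (1 : ℝ)) (Iio 1 ∩ Ioi 0) := by
        refine integrableOn_const ?_
        rw [Iio_inter_Ioi]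
        simp
      rw [IntegrableOn, integrable_indicator_iff measurableSet_Iio, IntegrableOn,
        Measure.restrict_restrict measurableSet_Iio]
      exact h1
    refine this.congr_fun (fun r hr => ?_) measurableSet_Ioi
    have hr : (0 : ℝ) < r := hr
    by_cases h : r < 1 <;> simp [h, indicator, hr.ne']

theorem log_one_add_inv_mul_le {r p l : ℝ} (hr : 0 ≤ r) (hp : 0 ≤ p) (hl : 0 < l) :
    Real.log (1 + r⁻¹) * p ≤ p + l * (if r < 1 then r⁻¹ else 0) + p ^ 2 / l := by
  have hpl : 0 ≤ p ^ 2 / l := by positivity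
  have ht : 0 ≤ r⁻¹ := inv_nonneg.2 hr
  split_ifs with h
  · set q := Real.sqrt r⁻¹ with hq
    have hq0 : 0 ≤ q := Real.sqrt_nonneg _
    have hqq : q ^ 2 = r⁻¹ := Real.sq_sqrt ht
    have h1 : Real.log (1 + r⁻¹) ≤ 2 * q := by
      calc Real.log (1 + r⁻¹) ≤ Real.log ((1 + q) ^ 2) := by
            apply Real.log_le_log (by positivity)
            rw [← hqq]; nlinarith
        _ = 2 * Real.log (1 + q) := by rw [Real.log_pow]; norm_num
        _ ≤ 2 * q := by
            have := Real.log_le_sub_one_of_pos (show 0 < 1 + q by positivity)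
            linarith
    have h2 : 2 * q * p ≤ l * q ^ 2 + p ^ 2 / l := by
      have : l * q ^ 2 + p ^ 2 / l - 2 * q * p = (l * q - p) ^ 2 / l := by field_simp; ring
      have : 0 ≤ (l * q - p) ^ 2 / l := by positivity
      linarith
    have := mul_le_mul_of_nonneg_right h1 hp
    rw [hqq] at h2
    linarith
  · have h1 : Real.log (1 + r⁻¹) ≤ 1 := by
      have := Real.log_le_sub_one_of_pos (show 0 < 1 + r⁻¹ by positivity)
      have := inv_le_one_of_one_le₀ (not_lt.1 h)
      linarith
    nlinarith

theorem log_eq_log_one_add_sub {r : ℝ} (hr : 0 ≤ r) :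
    Real.log r = Real.log (1 + r) - Real.log (1 + r⁻¹) := by
  rcases hr.eq_or_lt with rfl | h
  · simp
  · rw [← Real.log_div (by positivity) (by positivity)]
    congr 1
    field_simp
    ring

/-- The repulsive part of the logarithmic kernel weighted by a density. -/
def kerPos (ρ : Plane → ℝ) (p : Plane × Plane) : ℝ :=
  Real.log (1 + ‖p.1 - p.2‖) * ρ p.1 * ρ p.2

/-- The singular part of the logarithmic kernel weighted by a density. -/
def kerNeg (ρ : Plane → ℝ) (p : Plane × Plane) : ℝ :=
  Real.log (1 + ‖p.1 - p.2‖⁻¹) * ρ p.1 * ρ p.2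

theorem kerPos_nonneg {ρ : Plane → ℝ} (h0 : ∀ x, 0 ≤ ρ x) (p : Plane × Plane) :
    0 ≤ kerPos ρ p :=
  mul_nonneg (mul_nonneg (Real.log_nonneg (by simp)) (h0 _)) (h0 _)

theorem kerNeg_nonneg {ρ : Plane → ℝ} (h0 : ∀ x, 0 ≤ ρ x) (p : Plane × Plane) :
    0 ≤ kerNeg ρ p :=
  mul_nonneg (mul_nonneg (Real.log_nonneg (by simp)) (h0 _)) (h0 _)

section
variable {ρ : Plane → ℝ} (hm : Measurable ρ) (h0 : ∀ x, 0 ≤ ρ x) (h1 : Integrable ρ)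
include hm h0 h1

theorem integrable_kerPos (hw : Integrable fun x => ‖x‖ ^ 2 * ρ x) : Integrable (kerPos ρ) := by
  have hdom : Integrable (fun p : Plane × Plane => (ρ p.1 + ‖p.1‖ ^ 2 * ρ p.1) * ρ p.2 +
      ρ p.1 * (ρ p.2 + ‖p.2‖ ^ 2 * ρ p.2)) :=
    ((h1.add hw).mul_prod h1).add (h1.mul_prod (h1.add hw))
  refine hdom.mono' ?_ (ae_of_all _ fun p => ?_)
  · unfold kerPos
    exact Measurable.aestronglyMeasurable (by fun_prop)
  · rw [Real.norm_of_nonneg (kerPos_nonneg h0 p)]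
    have hl : Real.log (1 + ‖p.1 - p.2‖) ≤ (1 + ‖p.1‖ ^ 2) + (1 + ‖p.2‖ ^ 2) := by
      have a1 := Real.log_le_sub_one_of_pos (show 0 < 1 + ‖p.1 - p.2‖ by positivity)
      have a2 := norm_sub_le p.1 p.2
      nlinarith [sq_nonneg (‖p.1‖ - 1), sq_nonneg (‖p.2‖ - 1)]
    have := mul_le_mul_of_nonneg_right hl (mul_nonneg (h0 p.1) (h0 p.2))
    unfold kerPos
    linarith

theorem integrable_kerNeg_and_le (h2 : Integrable fun x => ρ x ^ 2) {l : ℝ} (hl : 0 < l) :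
    Integrable (kerNeg ρ) ∧ ∫ p, kerNeg ρ p ≤
      (∫ x, ρ x) * ((∫ x, ρ x) + l * (∫ z, singKernel z) + (∫ x, ρ x ^ 2) / l) := by
  have hmp := measurePreserving_sub_prod (volume : Measure Plane) (volume : Measure Plane)
  have hk : Integrable (fun q : Plane × Plane => singKernel q.1 * ρ q.2)
      ((volume : Measure Plane).prod volume) := integrable_singKernel.mul_prod h1
  have hk' : Integrable (fun p : Plane × Plane => singKernel (p.1 - p.2) * ρ p.2)
      ((volume : Measure Plane).prod volume) :=
    hmp.integrable_comp_of_integrable hk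
  have hkint : ∫ p : Plane × Plane, singKernel (p.1 - p.2) * ρ p.2 =
      (∫ z, singKernel z) * ∫ x, ρ x := by
    rw [← integral_prod_mul, Measure.volume_eq_prod]
    have := integral_map (μ := (volume : Measure Plane).prod volume) hmp.aemeasurable
      (f := fun q : Plane × Plane => singKernel q.1 * ρ q.2)
      (by rw [hmp.map_eq]; exact hk.aestronglyMeasurable)
    rw [hmp.map_eq] at this
    exact this.symm
  have i1 : Integrable (fun p : Plane × Plane => ρ p.1 * ρ p.2) := h1.mul_prod h1
  have i2 : Integrable (fun p : Plane × Plane => ρ p.1 ^ 2 * ρ p.2) := h2.mul_prod h1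
  have hdom : Integrable (fun p : Plane × Plane => ρ p.1 * ρ p.2 +
      l * (singKernel (p.1 - p.2) * ρ p.2) + (ρ p.1 ^ 2 * ρ p.2) / l) :=
    (i1.add (hk'.const_mul l)).add (i2.div_const l)
  have hle : ∀ p : Plane × Plane, kerNeg ρ p ≤ ρ p.1 * ρ p.2 +
      l * (singKernel (p.1 - p.2) * ρ p.2) + (ρ p.1 ^ 2 * ρ p.2) / l := fun p => by
    have := mul_le_mul_of_nonneg_right
      (log_one_add_inv_mul_le (norm_nonneg (p.1 - p.2)) (h0 p.1) hl) (h0 p.2)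
    unfold kerNeg singKernel
    calc _ ≤ _ := this
      _ = _ := by ring
  have hint : Integrable (kerNeg ρ) := by
    refine hdom.mono' ?_ (ae_of_all _ fun p => ?_)
    · unfold kerNeg
      exact Measurable.aestronglyMeasurable (by fun_prop)
    · rw [Real.norm_of_nonneg (kerNeg_nonneg h0 p)]
      exact hle p
  refine ⟨hint, (integral_mono hint hdom hle).trans_eq ?_⟩
  have i3 : Integrable (fun p : Plane × Plane => ρ p.1 * ρ p.2 +
      l * (singKernel (p.1 - p.2) * ρ p.2)) := i1.add (hk'.const_mul l)
  rw [integral_add i3 (i2.div_const l), integral_add i1 (hk'.const_mul l),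
    integral_const_mul, integral_div, hkint]
  have e1' := integral_prod_mul (μ := (volume : Measure Plane)) (ν := (volume : Measure Plane)) ρ ρ
  have e2' := integral_prod_mul (μ := (volume : Measure Plane)) (ν := (volume : Measure Plane))
    (fun x => ρ x ^ 2) ρ
  rw [Measure.volume_eq_prod, e1', e2']
  ring

theorem integrable_log_kernel (h2 : Integrable fun x => ρ x ^ 2)
    (hw : Integrable fun x => ‖x‖ ^ 2 * ρ x) :
    Integrable (fun p : Plane × Plane => Real.log ‖p.1 - p.2‖ * ρ p.1 * ρ p.2) ∧
    ∫ p : Plane × Plane, Real.log ‖p.1 - p.2‖ * ρ p.1 * ρ p.2 =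
      (∫ p, kerPos ρ p) - ∫ p, kerNeg ρ p := by
  have hP := integrable_kerPos hm h0 h1 hw
  have hN := (integrable_kerNeg_and_le hm h0 h1 h2 one_pos).1
  have e : (fun p : Plane × Plane => Real.log ‖p.1 - p.2‖ * ρ p.1 * ρ p.2) =
      fun p => kerPos ρ p - kerNeg ρ p := by
    funext p
    rw [log_eq_log_one_add_sub (norm_nonneg _)]
    unfold kerPos kerNeg
    ring
  rw [e]
  exact ⟨hP.sub hN, integral_sub hP hN⟩

end

theorem logConv_eq_integral_prod {u : Plane → ℂ}
    (h : Integrable (fun p : Plane × Plane => Real.log ‖p.1 - p.2‖ * ‖u p.1‖ ^ 2 * ‖u p.2‖ ^ 2)) :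
    logConv u = ∫ p : Plane × Plane, Real.log ‖p.1 - p.2‖ * ‖u p.1‖ ^ 2 * ‖u p.2‖ ^ 2 :=
  (integral_prod _ h).symm

theorem eq_smul_e0_add_smul_e1 (x : Plane) : x = x 0 • e0 + x 1 • e1 := by
  ext i
  fin_cases i <;> simp [e0, e1]

theorem norm_sq_eq_coords (x : Plane) : ‖x‖ ^ 2 = x 0 ^ 2 + x 1 ^ 2 := by
  simp [EuclideanSpace.norm_sq_eq, Fin.sum_univ_two]

theorem norm_dual_sq (L : Plane →L[ℝ] ℝ) : ‖L‖ ^ 2 = L e0 ^ 2 + L e1 ^ 2 := by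
  set v := (InnerProductSpace.toDual ℝ Plane).symm L with hv
  have hL : ∀ x, L x = inner ℝ v x := fun x => by
    rw [hv, InnerProductSpace.toDual_symm_apply]
  have hn : ‖L‖ = ‖v‖ := by rw [hv, LinearIsometryEquiv.norm_map]
  rw [hn, hL, hL, norm_sq_eq_coords]
  simp [e0, e1, EuclideanSpace.inner_single_right]

theorem fderiv_ofReal_comp_apply {w : Plane → ℝ} (hw : Differentiable ℝ w) (x v : Plane) :
    fderiv ℝ (fun y => (w y : ℂ)) x v = ((fderiv ℝ w x v : ℝ) : ℂ) := by
  have := (Complex.ofRealCLM.hasFDerivAt (x := w x)).comp x (hw x).hasFDerivAt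
  have h2 : fderiv ℝ (fun y => (w y : ℂ)) x = Complex.ofRealCLM.comp (fderiv ℝ w x) :=
    this.fderiv
  rw [h2]
  rfl

theorem gradSq_ofReal {w : Plane → ℝ} (hw : Differentiable ℝ w) (x : Plane) :
    gradSq (fun y => (w y : ℂ)) x = ‖fderiv ℝ w x‖ ^ 2 := by
  rw [norm_dual_sq]
  simp [gradSq, d0, d1, fderiv_ofReal_comp_apply hw]

theorem momentum_ofReal {w : Plane → ℝ} (hw : Differentiable ℝ w) (x : Plane) :
    momentum (fun y => (w y : ℂ)) x = 0 := by
  simp [momentum, d0, d1, fderiv_ofReal_comp_apply hw]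

/-- Compactly supported real trial functions. -/
structure IsTrial (w : Plane → ℝ) : Prop where
  diff : Differentiable ℝ w
  supp : HasCompactSupport w
  grad : Integrable fun x => ‖fderiv ℝ w x‖ ^ 2

namespace IsTrial

variable {w : Plane → ℝ} (h : IsTrial w)
include h

theorem integrable_mul_pow {V : Plane → ℝ} (hV : V110 V) {n : ℕ} (hn : n ≠ 0) :
    Integrable fun x => V x * w x ^ n := by
  obtain ⟨hm, h0, hb, -⟩ := hV
  obtain ⟨R, hR⟩ := h.supp.isCompact.isBounded.subset_closedBall (0 : Plane)
  obtain ⟨C, hC⟩ := hb R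
  have hc : Continuous fun x => w x ^ n := h.diff.continuous.pow n
  have hi : Integrable fun x => w x ^ n :=
    hc.integrable_of_hasCompactSupport (h.supp.comp_left (g := fun r : ℝ => r ^ n) (by simp [hn]))
  refine (hi.norm.const_mul C).mono' (hm.aestronglyMeasurable.mul hc.aestronglyMeasurable)
    (ae_of_all _ fun x => ?_)
  rw [norm_mul, Real.norm_of_nonneg (h0 x)]
  by_cases hx : w x = 0
  · simp [hx, hn]
  · have : x ∈ closedBall (0 : Plane) R := hR (subset_tsupport _ hx)
    exact mul_le_mul_of_nonneg_right (hC x (by simpa using this)) (norm_nonneg _)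

theorem integrable_pow {n : ℕ} (hn : n ≠ 0) : Integrable fun x => w x ^ n :=
  (h.diff.continuous.pow n).integrable_of_hasCompactSupport
    (h.supp.comp_left (g := fun r : ℝ => r ^ n) (by simp [hn]))

theorem inH1 : InH1 fun x => (w x : ℂ) := by
  refine ⟨?_, ?_, ?_⟩
  · exact Complex.ofRealCLM.differentiable.comp h.diff
  · simpa using h.integrable_pow two_ne_zero
  · have : gradSq (fun y => (w y : ℂ)) = fun x => ‖fderiv ℝ w x‖ ^ 2 :=
      funext (gradSq_ofReal h.diff)
    rw [this]
    exact h.grad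

theorem inH {V : Plane → ℝ} (hV : V110 V) : InH V fun x => (w x : ℂ) :=
  ⟨h.inH1, by simpa using h.integrable_mul_pow hV two_ne_zero⟩

theorem energy_eq {V : Plane → ℝ} (hV : V110 V) (Ω : ℝ) :
    Ea V Ω (fun x => (w x : ℂ)) = (∫ x, ‖fderiv ℝ w x‖ ^ 2) + (∫ x, V x * w x ^ 2) +
      (1 / 2) * logConv (fun x => (w x : ℂ)) - (1 / 2) * ∫ x, w x ^ 4 := by
  have e4 : ∀ x, |w x| ^ 4 = w x ^ 4 := fun x => Even.pow_abs ⟨2, rfl⟩ _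
  simp only [Ea, gradSq_ofReal h.diff, momentum_ofReal h.diff, Complex.norm_real,
    Real.norm_eq_abs, sq_abs, integral_zero, mul_zero, sub_zero, e4]
  rw [integral_add h.grad (h.integrable_mul_pow hV two_ne_zero)]

theorem const_mul (t : ℝ) : IsTrial fun x => t * w x where
  diff := h.diff.const_mul t
  supp := h.supp.mul_left (f := fun _ => t)
  grad := by
    have : (fun x => ‖fderiv ℝ (fun y => t * w y) x‖ ^ 2) =
        fun x => t ^ 2 * ‖fderiv ℝ w x‖ ^ 2 := by
      funext x
      rw [fderiv_const_mul (h.diff x), norm_smul, mul_pow, Real.norm_eq_abs, sq_abs]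
    rw [this]
    exact h.grad.const_mul _

theorem integral_grad_const_mul (t : ℝ) : ∫ x, ‖fderiv ℝ (fun y => t * w y) x‖ ^ 2 =
    t ^ 2 * ∫ x, ‖fderiv ℝ w x‖ ^ 2 := by
  rw [← integral_const_mul]
  refine integral_congr_ae (ae_of_all _ fun x => ?_)
  simp only
  rw [fderiv_const_mul (h.diff x), norm_smul, mul_pow, Real.norm_eq_abs, sq_abs]

theorem fderiv_dilate (τ : ℝ) (x : Plane) :
    ‖fderiv ℝ (fun y => τ * w (τ • y)) x‖ ^ 2 = τ ^ 4 * ‖fderiv ℝ w (τ • x)‖ ^ 2 := by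
  have h1 : HasFDerivAt (fun y => w (τ • y)) (τ • fderiv ℝ w (τ • x)) x := by
    have := (h.diff (τ • x)).hasFDerivAt.comp x ((hasFDerivAt_id x).const_smul τ)
    convert! this using 1
    ext v
    simp
  rw [(h1.const_mul τ).fderiv, norm_smul, norm_smul, mul_pow, mul_pow, Real.norm_eq_abs, sq_abs]
  ring

theorem dilate {τ : ℝ} (hτ : 0 < τ) : IsTrial fun x => τ * w (τ • x) where
  diff := (h.diff.comp (differentiable_id.const_smul τ)).const_mul τ
  supp := (h.supp.comp_smul hτ.ne').mul_left (f := fun _ => τ)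
  grad := by
    simp only [h.fderiv_dilate]
    exact (h.grad.comp_smul hτ.ne').const_mul _

omit h in
theorem integral_dilate_pow {τ : ℝ} (hτ : 0 < τ) (n : ℕ) :
    ∫ x, (τ * w (τ • x)) ^ (n + 2) = τ ^ n * ∫ x, w x ^ (n + 2) := by
  have := Measure.integral_comp_smul (volume : Measure Plane) (fun x => (τ * w x) ^ (n + 2)) τ
  rw [this, finrank_euclideanSpace_fin, abs_of_nonneg (by positivity)]
  simp only [mul_pow, smul_eq_mul]
  rw [integral_const_mul]
  field_simp
  ring

theorem integral_grad_dilate {τ : ℝ} (hτ : 0 < τ) :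
    ∫ x, ‖fderiv ℝ (fun y => τ * w (τ • y)) x‖ ^ 2 = τ ^ 2 * ∫ x, ‖fderiv ℝ w x‖ ^ 2 := by
  simp only [h.fderiv_dilate]
  rw [integral_const_mul,
    Measure.integral_comp_smul (volume : Measure Plane) (fun x => ‖fderiv ℝ w x‖ ^ 2) τ,
    finrank_euclideanSpace_fin, abs_of_nonneg (by positivity), smul_eq_mul]
  field_simp

theorem const_mul_mem_Sset {V : Plane → ℝ} (hV : V110 V) {a : ℝ} (ha : 0 < a)
    (hb : 0 < ∫ x, w x ^ 2) :
    (fun x => ((Real.sqrt (a / ∫ x, w x ^ 2) * w x : ℝ) : ℂ)) ∈ Sset V a := by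
  refine ⟨(h.const_mul _).inH hV, ?_⟩
  simp only [Complex.norm_real, Real.norm_eq_abs, sq_abs, mul_pow]
  rw [integral_const_mul, Real.sq_sqrt (by positivity)]
  field_simp

/-- The Gagliardo–Nirenberg inequality on compactly supported functions, as a consequence of the
lower boundedness of the energy on a mass sphere. -/
theorem gagliardo_nirenberg {V : Plane → ℝ} (hV : V110 V) {Ω a : ℝ} (ha : 0 < a) {u : Plane → ℂ}
    (hu : IsMinimizer V Ω a u) :
    a * ∫ x, w x ^ 4 ≤ 2 * (∫ x, w x ^ 2) * ∫ x, ‖fderiv ℝ w x‖ ^ 2 := by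
  set b := ∫ x, w x ^ 2 with hb_def
  set D := ∫ x, ‖fderiv ℝ w x‖ ^ 2 with hD
  set F := ∫ x, w x ^ 4 with hF
  have hb0 : 0 ≤ b := integral_nonneg fun x => sq_nonneg _
  rcases hb0.eq_or_lt with hb | hb
  · have hz : (fun x => w x ^ 2) =ᵐ[volume] 0 :=
      (integral_eq_zero_iff_of_nonneg (fun x => sq_nonneg _) (h.integrable_pow two_ne_zero)).1
        hb.symm
    have : F = 0 := by
      rw [hF]
      refine integral_eq_zero_of_ae ?_
      filter_upwards [hz] with x hx
      have : w x = 0 := by simpa using hx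
      simp [this]
    rw [this, ← hb]
    simp
  by_contra! hlt
  obtain ⟨R, hR⟩ := h.supp.isCompact.isBounded.subset_closedBall (0 : Plane)
  obtain ⟨C, hC⟩ := hV.2.2.1 1
  set s := a / b with hs
  have hs0 : 0 < s := by positivity
  have hneg : 0 < s * F / 2 - D := by
    have : s * F / 2 - D = (a * F - 2 * b * D) / (2 * b) := by rw [hs]; field_simp
    rw [this]
    apply div_pos <;> linarith
  have key : ∀ τ : ℝ, 1 ≤ τ → 2 * R ≤ τ →
      Ea V Ω u ≤ -(τ ^ 2 * (s * (s * F / 2 - D))) + |C| * a := by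
    intro τ h1 h2
    have hτ : 0 < τ := by linarith
    have hd := h.dilate hτ
    have hmass : ∫ x, (τ * w (τ • x)) ^ 2 = b := by
      simpa using integral_dilate_pow (w := w) hτ 0
    have hmem := hd.const_mul_mem_Sset hV ha (by rw [hmass]; exact hb)
    have hE := hu.2 _ hmem
    rw [hmass] at hE
    refine hE.trans ?_
    set t := Real.sqrt (a / b) with ht
    have ht2 : t ^ 2 = s := Real.sq_sqrt hs0.le
    have hdt := hd.const_mul t
    have hsupp : ∀ x, t * (τ * w (τ • x)) ≠ 0 → ‖x‖ ≤ 1 / 2 := by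
      intro x hx
      have hx' : w (τ • x) ≠ 0 := by
        intro h0; simp [h0] at hx
      have : τ • x ∈ closedBall (0 : Plane) R := hR (subset_tsupport _ hx')
      rw [mem_closedBall_zero_iff, norm_smul, Real.norm_of_nonneg hτ.le] at this
      by_contra! hc
      nlinarith
    rw [hdt.energy_eq hV, hd.integral_grad_const_mul, h.integral_grad_dilate hτ, ← hD]
    have hF' : ∫ x, (t * (τ * w (τ • x))) ^ 4 = s ^ 2 * (τ ^ 2 * F) := by
      have := integral_dilate_pow (w := w) hτ 2
      simp only [mul_pow t] at *
      rw [integral_const_mul, this, ← ht2]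
      ring
    have hVle : ∫ x, V x * (t * (τ * w (τ • x))) ^ 2 ≤ |C| * a := by
      have hm2 : ∫ x, (t * (τ * w (τ • x))) ^ 2 = a := by
        simp only [mul_pow t]
        rw [integral_const_mul, hmass, ht2, hs]
        field_simp
      rw [← hm2, ← integral_const_mul]
      refine integral_mono (hdt.integrable_mul_pow hV two_ne_zero)
        ((hdt.integrable_pow two_ne_zero).const_mul _) fun x => ?_
      by_cases hx : t * (τ * w (τ • x)) = 0
      · simp [hx]
      · exact mul_le_mul_of_nonneg_right ((hC x (by linarith [hsupp x hx])).trans (le_abs_self C))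
          (sq_nonneg _)
    have hlog : logConv (fun x => ((t * (τ * w (τ • x)) : ℝ) : ℂ)) ≤ 0 := by
      refine integral_nonpos fun x => integral_nonpos fun y => ?_
      simp only [Complex.norm_real, Real.norm_eq_abs, sq_abs, Pi.zero_apply]
      by_cases hx : t * (τ * w (τ • x)) = 0
      · simp [hx]
      by_cases hy : t * (τ * w (τ • y)) = 0
      · simp [hy]
      have : Real.log ‖x - y‖ ≤ 0 := by
        refine Real.log_nonpos (norm_nonneg _) ((norm_sub_le _ _).trans ?_)
        linarith [hsupp x hx, hsupp y hy]
      exact mul_nonpos_of_nonpos_of_nonneg (mul_nonpos_of_nonpos_of_nonneg this (sq_nonneg _))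
        (sq_nonneg _)
    rw [hF', ht2]
    nlinarith
  have hp : 0 < s * (s * F / 2 - D) := mul_pos hs0 hneg
  set A := |(|C| * a - Ea V Ω u)| / (s * (s * F / 2 - D)) with hA
  have hA0 : 0 ≤ A := by positivity
  have := key (1 + A + |2 * R|) (by linarith [abs_nonneg (2 * R)])
    (by linarith [le_abs_self (2 * R)])
  have h3 : A < (1 + A + |2 * R|) ^ 2 := by nlinarith [abs_nonneg (2 * R)]
  have h4 : A * (s * (s * F / 2 - D)) = |(|C| * a - Ea V Ω u)| := by
    rw [hA, div_mul_cancel₀ _ hp.ne']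
  have h5 := mul_lt_mul_of_pos_right h3 hp
  linarith [le_abs_self (|C| * a - Ea V Ω u)]

end IsTrial

theorem fderiv_norm_eq_zero_of_eq_zero {u : Plane → ℂ} {x : Plane} (hx : u x = 0) :
    fderiv ℝ (fun y => ‖u y‖) x = 0 :=
  IsLocalMin.fderiv_eq_zero (Eventually.of_forall fun y => by simp [hx])

theorem fderiv_norm_sq_eq_smul {u : Plane → ℂ} (hu : Differentiable ℝ u) (x : Plane) :
    fderiv ℝ (fun y => ‖u y‖ ^ 2) x = (2 * ‖u x‖) • fderiv ℝ (fun y => ‖u y‖) x := by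
  by_cases hx : u x = 0
  · rw [fderiv_norm_eq_zero_of_eq_zero hx, smul_zero]
    exact IsLocalMin.fderiv_eq_zero (Eventually.of_forall fun y => by simp [hx])
  · have h := ((hu x).norm ℝ hx).hasFDerivAt.pow 2
    have h' := h.fderiv
    simpa using h'

theorem norm_mul_fderiv_norm {u : Plane → ℂ} (hu : Differentiable ℝ u) (x v : Plane) :
    ‖u x‖ * fderiv ℝ (fun y => ‖u y‖) x v = inner ℝ (u x) (fderiv ℝ u x v) := by
  have h := fderiv_norm_sq_comp_apply hu x v
  rw [fderiv_norm_sq_eq_smul hu] at h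
  simp only [_root_.smul_apply, smul_eq_mul] at h
  linarith

theorem inner_sq_add_im_sq (z w : ℂ) :
    inner ℝ z w ^ 2 + ((starRingEnd ℂ) z * w).im ^ 2 = ‖z‖ ^ 2 * ‖w‖ ^ 2 := by
  rw [Complex.inner, ← Complex.normSq_eq_norm_sq, ← Complex.normSq_eq_norm_sq,
    Complex.normSq_apply, Complex.normSq_apply]
  simp
  ring

/-- The diamagnetic inequality for the rotation field. -/
theorem gradAbsSq_le {u : Plane → ℂ} (hu : Differentiable ℝ u) (Ω : ℝ) (x : Plane) :
    gradAbsSq u x ≤ gradSq u x - Ω * momentum u x + Ω ^ 2 / 4 * ‖x‖ ^ 2 * ‖u x‖ ^ 2 := by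
  by_cases hx : u x = 0
  · have : gradAbsSq u x = 0 := by simp [gradAbsSq, fderiv_norm_eq_zero_of_eq_zero hx]
    rw [this]
    simp only [gradSq, momentum, hx]
    simp
    positivity
  · have hN : 0 < ‖u x‖ ^ 2 := by positivity
    have h0 := norm_mul_fderiv_norm hu x e0
    have h1 := norm_mul_fderiv_norm hu x e1
    have k0 := inner_sq_add_im_sq (u x) (d0 u x)
    have k1 := inner_sq_add_im_sq (u x) (d1 u x)
    unfold gradAbsSq
    rw [norm_dual_sq, norm_sq_eq_coords]
    unfold gradSq momentum
    refine le_of_mul_le_mul_left ?_ hN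
    set q0 := ((starRingEnd ℂ) (u x) * d0 u x).im
    set q1 := ((starRingEnd ℂ) (u x) * d1 u x).im
    set N := ‖u x‖
    have e0' : (N * fderiv ℝ (fun y => ‖u y‖) x e0) ^ 2 = N ^ 2 * ‖d0 u x‖ ^ 2 - q0 ^ 2 := by
      rw [h0, ← k0]; simp [d0]
    have e1' : (N * fderiv ℝ (fun y => ‖u y‖) x e1) ^ 2 = N ^ 2 * ‖d1 u x‖ ^ 2 - q1 ^ 2 := by
      rw [h1, ← k1]; simp [d1]
    nlinarith [sq_nonneg (q0 + Ω / 2 * x 1 * N ^ 2), sq_nonneg (q1 - Ω / 2 * x 0 * N ^ 2)]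

theorem gradAbsSq_nonneg (u : Plane → ℂ) (x : Plane) : 0 ≤ gradAbsSq u x := sq_nonneg _

theorem InH1.integrable_gradAbsSq {u : Plane → ℂ} (hu : InH1 u) : Integrable (gradAbsSq u) := by
  refine hu.2.2.mono' ((measurable_fderiv ℝ fun y => ‖u y‖).norm.pow_const 2).aestronglyMeasurable
    (ae_of_all _ fun x => ?_)
  rw [Real.norm_of_nonneg (gradAbsSq_nonneg u x)]
  simpa using gradAbsSq_le hu.1 0 x

/-- A smooth radial-type cutoff with derivative bounded by `K`. -/
structure IsCutoff (χ : Plane → ℝ) (K : ℝ) : Prop where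
  smooth : ContDiff ℝ 2 χ
  nonneg : ∀ x, 0 ≤ χ x
  le_one : ∀ x, χ x ≤ 1
  eq_one : ∀ x, ‖x‖ ≤ 1 / 2 → χ x = 1
  eq_zero : ∀ x, 1 ≤ ‖x‖ → χ x = 0
  bound : ∀ x, ‖fderiv ℝ χ x‖ ≤ K

theorem exists_isCutoff : ∃ χ K, IsCutoff χ K := by
  let f : ContDiffBump (0 : Plane) := ⟨1 / 2, 1, by norm_num, by norm_num⟩
  have hs : ContDiff ℝ 2 f := f.contDiff
  have hc : Continuous (fderiv ℝ f) := hs.continuous_fderiv (by norm_num)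
  obtain ⟨K, hK⟩ := hc.bounded_above_of_compact_support (f.hasCompactSupport.fderiv ℝ)
  refine ⟨f, K, hs, fun x => f.nonneg, fun x => f.le_one, fun x hx => ?_, fun x hx => ?_, hK⟩
  · exact f.one_of_mem_closedBall (by rw [mem_closedBall_zero_iff]; exact hx)
  · exact f.zero_of_le_dist (by simpa using hx)

namespace IsCutoff

variable {χ : Plane → ℝ} {K : ℝ} (h : IsCutoff χ K)
include h

theorem const_nonneg : 0 ≤ K := (norm_nonneg _).trans (h.bound 0)

theorem contDiff_dilate (R : ℝ) : ContDiff ℝ 2 fun x => χ (R⁻¹ • x) :=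
  h.smooth.comp (contDiff_id.const_smul R⁻¹)

theorem fderiv_dilate (R : ℝ) (x : Plane) :
    fderiv ℝ (fun y => χ (R⁻¹ • y)) x = R⁻¹ • fderiv ℝ χ (R⁻¹ • x) := by
  have hd : Differentiable ℝ χ := h.smooth.differentiable (by norm_num)
  have h1 := (hd (R⁻¹ • x)).hasFDerivAt.comp x ((hasFDerivAt_id x).const_smul R⁻¹)
  have h2 : fderiv ℝ (fun y => χ (R⁻¹ • y)) x = _ := h1.fderiv
  rw [h2]
  ext v
  simp

theorem norm_fderiv_dilate_le {R : ℝ} (hR : 0 < R) (x : Plane) :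
    ‖fderiv ℝ (fun y => χ (R⁻¹ • y)) x‖ ≤ K / R := by
  rw [h.fderiv_dilate, norm_smul, Real.norm_of_nonneg (by positivity), div_eq_inv_mul]
  exact mul_le_mul_of_nonneg_left (h.bound _) (by positivity)

theorem dilate_eq_one {R : ℝ} (hR : 0 < R) {x : Plane} (hx : ‖x‖ ≤ R / 2) : χ (R⁻¹ • x) = 1 := by
  apply h.eq_one
  rw [norm_smul, Real.norm_of_nonneg (by positivity), inv_mul_le_iff₀ hR]
  linarith

theorem dilate_eq_zero {R : ℝ} (hR : 0 < R) {x : Plane} (hx : R ≤ ‖x‖) : χ (R⁻¹ • x) = 0 := by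
  apply h.eq_zero
  rw [norm_smul, Real.norm_of_nonneg (by positivity), le_inv_mul_iff₀ hR]
  linarith

theorem hasCompactSupport_dilate {R : ℝ} (hR : 0 < R) :
    HasCompactSupport fun x => χ (R⁻¹ • x) := by
  refine HasCompactSupport.intro (isCompact_closedBall (0 : Plane) R) fun x hx => ?_
  exact h.dilate_eq_zero hR (by simp at hx; exact hx.le)

theorem fderiv_dilate_eq_zero_of_lt {R : ℝ} (hR : 0 < R) {x : Plane} (hx : ‖x‖ < R / 2) :
    fderiv ℝ (fun y => χ (R⁻¹ • y)) x = 0 := by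
  have : (fun y => χ (R⁻¹ • y)) =ᶠ[𝓝 x] fun _ => 1 := by
    filter_upwards [(isOpen_lt continuous_norm continuous_const).mem_nhds hx] with y hy
    exact h.dilate_eq_one hR (le_of_lt hy)
  rw [this.fderiv_eq]
  simp

theorem fderiv_dilate_eq_zero_of_gt {R : ℝ} (hR : 0 < R) {x : Plane} (hx : R < ‖x‖) :
    fderiv ℝ (fun y => χ (R⁻¹ • y)) x = 0 := by
  have : (fun y => χ (R⁻¹ • y)) =ᶠ[𝓝 x] fun _ => 0 := by
    filter_upwards [(isOpen_lt continuous_const continuous_norm).mem_nhds hx] with y hy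
    exact h.dilate_eq_zero hR (le_of_lt hy)
  rw [this.fderiv_eq]
  simp

theorem tendsto_dilate (x : Plane) :
    Tendsto (fun n : ℕ => χ (((n : ℝ) + 1)⁻¹ • x)) atTop (𝓝 1) := by
  refine tendsto_const_nhds.congr' ?_
  filter_upwards [tendsto_natCast_atTop_atTop.eventually_ge_atTop (2 * ‖x‖)] with n hn
  exact (h.dilate_eq_one (by positivity) (by linarith)).symm

end IsCutoff

/-- A smooth regularization of the modulus. -/
def regAbs (u : Plane → ℂ) (δ : ℝ) (x : Plane) : ℝ := Real.sqrt (‖u x‖ ^ 2 + δ ^ 2) - δ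

theorem regAbs_nonneg (u : Plane → ℂ) (δ : ℝ) (x : Plane) : 0 ≤ regAbs u δ x :=
  sub_nonneg.2 (Real.le_sqrt_of_sq_le (by nlinarith [sq_nonneg ‖u x‖]))

section
variable {u : Plane → ℂ} {δ : ℝ} (hδ : 0 < δ)
include hδ

theorem regAbs_le (x : Plane) : regAbs u δ x ≤ ‖u x‖ := by
  rw [regAbs, sub_le_iff_le_add]
  refine Real.sqrt_le_iff.2 ⟨by positivity, ?_⟩
  nlinarith [norm_nonneg (u x), mul_nonneg (norm_nonneg (u x)) hδ.le]

theorem differentiable_regAbs (hu : Differentiable ℝ u) : Differentiable ℝ (regAbs u δ) :=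
  fun x => (((hu.norm_sq ℝ x).add_const (δ ^ 2)).sqrt (by positivity)).sub_const δ

theorem norm_fderiv_regAbs_sq_le (hu : Differentiable ℝ u) (x : Plane) :
    ‖fderiv ℝ (regAbs u δ) x‖ ^ 2 ≤ gradAbsSq u x := by
  have h1 : HasFDerivAt (regAbs u δ) _ x :=
    (((hu.norm_sq ℝ x).hasFDerivAt.add_const (δ ^ 2)).sqrt (by positivity)).sub_const δ
  rw [h1.fderiv, fderiv_norm_sq_eq_smul hu, smul_smul, norm_smul, gradAbsSq, mul_pow]
  refine mul_le_of_le_one_left (sq_nonneg _) ?_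
  rw [Real.norm_eq_abs, sq_abs]
  have hs : 0 < Real.sqrt (‖u x‖ ^ 2 + δ ^ 2) := Real.sqrt_pos.2 (by positivity)
  have hs2 := Real.sq_sqrt (show 0 ≤ ‖u x‖ ^ 2 + δ ^ 2 by positivity)
  have : 1 / (2 * Real.sqrt (‖u x‖ ^ 2 + δ ^ 2)) * (2 * ‖u x‖) =
      ‖u x‖ / Real.sqrt (‖u x‖ ^ 2 + δ ^ 2) := by field_simp
  rw [this, div_pow, hs2]
  exact div_le_one_of_le₀ (by nlinarith [sq_nonneg δ]) (by positivity)

end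

theorem tendsto_regAbs (u : Plane → ℂ) (x : Plane) :
    Tendsto (fun n : ℕ => regAbs u (1 / ((n : ℝ) + 1)) x) atTop (𝓝 ‖u x‖) := by
  have h := tendsto_one_div_add_atTop_nhds_zero_nat (𝕜 := ℝ)
  have := ((((h.pow 2).const_add (‖u x‖ ^ 2)).sqrt).sub h)
  simpa [regAbs, Real.sqrt_sq (norm_nonneg _)] using this

/-- The squared gradient of a product with a cutoff. -/
theorem norm_fderiv_mul_sq_le {f g : Plane → ℝ} {x : Plane} {R B : ℝ} (hR : 1 ≤ R)
    (hf : DifferentiableAt ℝ f x) (hg : DifferentiableAt ℝ g x) (hf0 : 0 ≤ f x) (hf1 : f x ≤ 1)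
    (hfd : ‖fderiv ℝ f x‖ ≤ B / R) :
    ‖fderiv ℝ (fun y => f y * g y) x‖ ^ 2 ≤
      (1 + 1 / R) * ‖fderiv ℝ g x‖ ^ 2 + 2 * B ^ 2 / R * g x ^ 2 := by
  have hR0 : 0 < R := by linarith
  have h1 : ‖fderiv ℝ (fun y => f y * g y) x‖ ≤ ‖fderiv ℝ g x‖ + |g x| * (B / R) := by
    rw [fderiv_fun_mul hf hg]
    refine (norm_add_le _ _).trans ?_
    rw [norm_smul, norm_smul, Real.norm_of_nonneg hf0, Real.norm_eq_abs]
    exact add_le_add (mul_le_of_le_one_left (norm_nonneg _) hf1)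
      (mul_le_mul_of_nonneg_left hfd (abs_nonneg _))
  set p := ‖fderiv ℝ g x‖
  set q := |g x| * B with hq
  have hq2 : q ^ 2 = B ^ 2 * g x ^ 2 := by rw [hq, mul_pow, sq_abs]; ring
  have h2 : ‖fderiv ℝ (fun y => f y * g y) x‖ ^ 2 ≤ (p + q / R) ^ 2 := by
    refine pow_le_pow_left₀ (norm_nonneg _) (h1.trans_eq ?_) 2
    rw [hq]; ring
  refine h2.trans ?_
  have : (1 + 1 / R) * p ^ 2 + 2 * B ^ 2 / R * g x ^ 2 - (p + q / R) ^ 2 =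
      (p - q) ^ 2 / R + (R - 1) * q ^ 2 / R ^ 2 := by
    have : 2 * B ^ 2 / R * g x ^ 2 = 2 * q ^ 2 / R := by rw [hq2]; ring
    rw [this]
    field_simp
    ring
  have h3 : 0 ≤ (p - q) ^ 2 / R + (R - 1) * q ^ 2 / R ^ 2 := by
    have : 0 ≤ R - 1 := by linarith
    positivity
  linarith

/-- The Gagliardo–Nirenberg inequality passes from compactly supported real functions to moduli of
`H¹` functions. -/
theorem InH1.gagliardo_nirenberg_abs {u : Plane → ℂ} (hu : InH1 u) {a : ℝ}
    (hGN : ∀ w, IsTrial w → a * ∫ x, w x ^ 4 ≤ 2 * (∫ x, w x ^ 2) * ∫ x, ‖fderiv ℝ w x‖ ^ 2) :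
    a * ∫ x, ‖u x‖ ^ 4 ≤ 2 * (∫ x, ‖u x‖ ^ 2) * ∫ x, gradAbsSq u x := by
  obtain ⟨χ, K, hχ⟩ := exists_isCutoff
  have hd := hu.1
  have h4 := hu.integrable_pow_four.1
  have hG := hu.integrable_gradAbsSq
  set v : ℕ → Plane → ℝ := fun n x =>
    χ (((n : ℝ) + 1)⁻¹ • x) * regAbs u (1 / ((n : ℝ) + 1)) x with hv
  have hδ : ∀ n : ℕ, 0 < 1 / ((n : ℝ) + 1) := fun n => by positivity
  have hv0 : ∀ n x, 0 ≤ v n x := fun n x => mul_nonneg (hχ.nonneg _) (regAbs_nonneg u _ x)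
  have hvle : ∀ n x, v n x ≤ ‖u x‖ := fun n x =>
    (mul_le_of_le_one_left (regAbs_nonneg u _ x) (hχ.le_one _)).trans (regAbs_le (hδ n) x)
  have hχd : ∀ n : ℕ, Differentiable ℝ fun x => χ (((n : ℝ) + 1)⁻¹ • x) := fun n =>
    (hχ.contDiff_dilate _).differentiable (by norm_num)
  have hvd : ∀ n, Differentiable ℝ (v n) := fun n =>
    (hχd n).mul (differentiable_regAbs (hδ n) hd)
  have hgrad : ∀ (n : ℕ) x, ‖fderiv ℝ (v n) x‖ ^ 2 ≤
      (1 + 1 / ((n : ℝ) + 1)) * gradAbsSq u x + 2 * K ^ 2 / ((n : ℝ) + 1) * ‖u x‖ ^ 2 := by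
    intro n x
    refine (norm_fderiv_mul_sq_le (R := (n : ℝ) + 1) (B := K) (by simp) (hχd n x)
      (differentiable_regAbs (hδ n) hd x) (hχ.nonneg _) (hχ.le_one _)
      (hχ.norm_fderiv_dilate_le (by positivity) x)).trans ?_
    have a1 := norm_fderiv_regAbs_sq_le (hδ n) hd x
    have a2 := pow_le_pow_left₀ (regAbs_nonneg u _ x) (regAbs_le (hδ n) x) 2
    gcongr
  have hdom : ∀ n : ℕ, Integrable fun x => (1 + 1 / ((n : ℝ) + 1)) * gradAbsSq u x +
      2 * K ^ 2 / ((n : ℝ) + 1) * ‖u x‖ ^ 2 := fun n =>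
    (hG.const_mul _).add (hu.2.1.const_mul _)
  have htrial : ∀ n, IsTrial (v n) := fun n =>
    { diff := hvd n
      supp := (hχ.hasCompactSupport_dilate (by positivity)).mul_right
      grad := (hdom n).mono' ((measurable_fderiv ℝ _).norm.pow_const 2).aestronglyMeasurable
        (ae_of_all _ fun x => by
          rw [Real.norm_of_nonneg (sq_nonneg _)]
          exact hgrad n x) }
  have hF : Tendsto (fun n => ∫ x, v n x ^ 4) atTop (𝓝 (∫ x, ‖u x‖ ^ 4)) := by
    refine tendsto_integral_of_dominated_convergence (fun x => ‖u x‖ ^ 4)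
      (fun n => ((hvd n).continuous.pow 4).aestronglyMeasurable) h4 (fun n => ae_of_all _ fun x => ?_)
      (ae_of_all _ fun x => ?_)
    · rw [Real.norm_of_nonneg (pow_nonneg (hv0 n x) 4)]
      exact pow_le_pow_left₀ (hv0 n x) (hvle n x) 4
    · have := ((hχ.tendsto_dilate x).mul (tendsto_regAbs u x)).pow 4
      simpa [hv] using this
  have hle : ∀ n : ℕ, a * ∫ x, v n x ^ 4 ≤ 2 * (∫ x, ‖u x‖ ^ 2) *
      ((1 + 1 / ((n : ℝ) + 1)) * (∫ x, gradAbsSq u x) +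
        2 * K ^ 2 * (1 / ((n : ℝ) + 1)) * ∫ x, ‖u x‖ ^ 2) := by
    intro n
    refine (hGN _ (htrial n)).trans ?_
    have a1 : ∫ x, v n x ^ 2 ≤ ∫ x, ‖u x‖ ^ 2 :=
      integral_mono ((htrial n).integrable_pow two_ne_zero) hu.2.1
        fun x => pow_le_pow_left₀ (hv0 n x) (hvle n x) 2
    have a2 : ∫ x, ‖fderiv ℝ (v n) x‖ ^ 2 ≤ (1 + 1 / ((n : ℝ) + 1)) * (∫ x, gradAbsSq u x) +
        2 * K ^ 2 * (1 / ((n : ℝ) + 1)) * ∫ x, ‖u x‖ ^ 2 := by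
      refine (integral_mono (htrial n).grad (hdom n) (hgrad n)).trans_eq ?_
      rw [integral_add (hG.const_mul _) (hu.2.1.const_mul _), integral_const_mul,
        integral_const_mul]
      ring
    have a3 : 0 ≤ ∫ x, ‖fderiv ℝ (v n) x‖ ^ 2 := integral_nonneg fun x => sq_nonneg _
    have a4 : 0 ≤ ∫ x, ‖u x‖ ^ 2 := integral_nonneg fun x => sq_nonneg _
    gcongr
  have h0 := tendsto_one_div_add_atTop_nhds_zero_nat (𝕜 := ℝ)
  have hR := (((h0.const_add 1).mul_const (∫ x, gradAbsSq u x)).add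
    ((h0.const_mul (2 * K ^ 2)).mul_const (∫ x, ‖u x‖ ^ 2))).const_mul (2 * ∫ x, ‖u x‖ ^ 2)
  have := le_of_tendsto_of_tendsto' (hF.const_mul a) hR hle
  simpa using this

theorem integral_fderiv_eq_zero {f : Plane → ℝ} (hf : ContDiff ℝ 1 f) (hs : HasCompactSupport f)
    (v : Plane) : ∫ x, fderiv ℝ f x v = 0 := by
  have hi : Integrable fun x => fderiv ℝ f x v :=
    ((hf.continuous_fderiv one_ne_zero).clm_apply continuous_const).integrable_of_hasCompactSupport
      (hs.fderiv_apply ℝ v)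
  have := integral_mul_fderiv_eq_neg_fderiv_mul_of_integrable (μ := (volume : Measure Plane))
    (f := fun _ : Plane => (1 : ℝ)) (g := f) (v := v) (by simp) (by simpa using hi)
    (by simpa using hf.continuous.integrable_of_hasCompactSupport hs)
    (fun x _ => differentiableAt_const _) (fun x _ => hf.differentiable one_ne_zero x)
  simpa using this

namespace IsGroundState

variable {Q : Plane → ℝ} (hQ : IsGroundState Q)
include hQ

theorem contDiff : ContDiff ℝ 2 Q := hQ.1

theorem differentiable : Differentiable ℝ Q := hQ.1.differentiable (by norm_num)

theorem continuous : Continuous Q := hQ.1.continuous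

theorem contDiff_fderiv_apply (v : Plane) : ContDiff ℝ 1 fun x => fderiv ℝ Q x v :=
  (hQ.1.fderiv_right (m := 1) (by norm_num)).clm_apply contDiff_const

theorem hasFDerivAt (x : Plane) : HasFDerivAt Q (fderiv ℝ Q x) x :=
  (hQ.differentiable x).hasFDerivAt

theorem hasFDerivAt_fderiv_apply (v x : Plane) :
    HasFDerivAt (fun y => fderiv ℝ Q y v) (fderiv ℝ (fun y => fderiv ℝ Q y v) x) x :=
  ((hQ.contDiff_fderiv_apply v).differentiable one_ne_zero x).hasFDerivAt

theorem equation (x : Plane) : fderiv ℝ (fun y => fderiv ℝ Q y e0) x e0 +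
    fderiv ℝ (fun y => fderiv ℝ Q y e1) x e1 = Q x - Q x ^ 3 := by
  have := hQ.2.2.2.2.2 x
  simp only [lapR] at this
  change fderiv ℝ (d0R Q) x e0 + fderiv ℝ (d1R Q) x e1 = _
  linarith

theorem integrable_sq : Integrable fun x => Q x ^ 2 := hQ.2.2.2.1

theorem integrable_grad_sq : Integrable fun x => ‖fderiv ℝ Q x‖ ^ 2 := hQ.2.2.2.2.1

theorem integrable_pow_four : Integrable fun x => Q x ^ 4 := by
  have h : InH1 fun x => (Q x : ℂ) := by
    refine ⟨Complex.ofRealCLM.differentiable.comp hQ.differentiable, ?_, ?_⟩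
    · simpa using hQ.integrable_sq
    · rw [funext (gradSq_ofReal hQ.differentiable)]
      exact hQ.integrable_grad_sq
  have e4 : ∀ x, |Q x| ^ 4 = Q x ^ 4 := fun x => Even.pow_abs ⟨2, rfl⟩ _
  simpa [e4] using h.integrable_pow_four.1

theorem integral_sq_pos : 0 < ∫ x, Q x ^ 2 := by
  rw [integral_pos_iff_support_of_nonneg (fun x => sq_nonneg _) hQ.integrable_sq]
  have : Function.support (fun x => Q x ^ 2) = univ := by
    ext x
    simp [(hQ.2.1 x).ne']
  rw [this]
  exact Measure.measure_univ_pos.2 (NeZero.ne _)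

theorem norm_fderiv_mul_sq {φ : Plane → ℝ} (hφ : Differentiable ℝ φ) (x : Plane) :
    ‖fderiv ℝ (fun y => φ y * Q y) x‖ ^ 2 =
      ‖fderiv ℝ φ x‖ ^ 2 * Q x ^ 2 + φ x ^ 2 * (Q x ^ 4 - Q x ^ 2) +
        (fderiv ℝ (fun y => φ y ^ 2 * Q y * fderiv ℝ Q y e0) x e0 +
          fderiv ℝ (fun y => φ y ^ 2 * Q y * fderiv ℝ Q y e1) x e1) := by
  have h1 : ∀ v, fderiv ℝ (fun y => φ y ^ 2 * Q y * fderiv ℝ Q y v) x v =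
      2 * φ x * fderiv ℝ φ x v * Q x * fderiv ℝ Q x v + φ x ^ 2 * fderiv ℝ Q x v ^ 2 +
        φ x ^ 2 * Q x * fderiv ℝ (fun y => fderiv ℝ Q y v) x v := by
    intro v
    have := ((((hφ x).hasFDerivAt.pow 2).mul (hQ.hasFDerivAt x)).mul
      (hQ.hasFDerivAt_fderiv_apply v x)).fderiv
    have h2 := congrArg (fun L : Plane →L[ℝ] ℝ => L v) this
    simp only [_root_.add_apply, _root_.smul_apply, smul_eq_mul, Pi.mul_apply] at h2
    refine Eq.trans ?_ (h2.trans ?_)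
    · rfl
    · norm_num
      ring
  have h3 : ∀ v, fderiv ℝ (fun y => φ y * Q y) x v =
      φ x * fderiv ℝ Q x v + Q x * fderiv ℝ φ x v := by
    intro v
    rw [fderiv_fun_mul (hφ x) (hQ.differentiable x)]
    simp
  rw [norm_dual_sq, norm_dual_sq, h1, h1, h3, h3]
  have := hQ.equation x
  linear_combination (-(φ x ^ 2 * Q x)) * this

theorem integral_norm_fderiv_mul_sq {φ : Plane → ℝ} (hφ : ContDiff ℝ 1 φ)
    (hs : HasCompactSupport φ) :
    IsTrial (fun y => φ y * Q y) ∧ Integrable (fun x => ‖fderiv ℝ φ x‖ ^ 2 * Q x ^ 2) ∧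
    Integrable (fun x => φ x ^ 2 * Q x ^ 4) ∧ Integrable (fun x => φ x ^ 2 * Q x ^ 2) ∧
    ∫ x, ‖fderiv ℝ (fun y => φ y * Q y) x‖ ^ 2 =
      (∫ x, ‖fderiv ℝ φ x‖ ^ 2 * Q x ^ 2) + (∫ x, φ x ^ 2 * Q x ^ 4) - ∫ x, φ x ^ 2 * Q x ^ 2 := by
  have hd := hφ.differentiable one_ne_zero
  have hsq : HasCompactSupport fun x => φ x ^ 2 :=
    hs.comp_left (g := fun r : ℝ => r ^ 2) (by simp)
  have s1 : HasCompactSupport fun x => ‖fderiv ℝ φ x‖ ^ 2 :=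
    (hs.fderiv ℝ).comp_left (g := fun L : Plane →L[ℝ] ℝ => ‖L‖ ^ 2) (by simp)
  have i1 : Integrable fun x => ‖fderiv ℝ φ x‖ ^ 2 * Q x ^ 2 :=
    Continuous.integrable_of_hasCompactSupport
      (((hφ.continuous_fderiv one_ne_zero).norm.pow 2).mul (hQ.continuous.pow 2)) s1.mul_right
  have i2 : Integrable fun x => φ x ^ 2 * Q x ^ 4 :=
    Continuous.integrable_of_hasCompactSupport
      ((hφ.continuous.pow 2).mul (hQ.continuous.pow 4)) hsq.mul_right
  have i3 : Integrable fun x => φ x ^ 2 * Q x ^ 2 :=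
    Continuous.integrable_of_hasCompactSupport
      ((hφ.continuous.pow 2).mul (hQ.continuous.pow 2)) hsq.mul_right
  have hQ1 : ContDiff ℝ 1 Q := hQ.contDiff.of_le (by norm_num)
  have hc : ∀ v, ContDiff ℝ 1 fun y => φ y ^ 2 * Q y * fderiv ℝ Q y v := fun v =>
    ((hφ.pow 2).mul hQ1).mul (hQ.contDiff_fderiv_apply v)
  have hcs : ∀ v, HasCompactSupport fun y => φ y ^ 2 * Q y * fderiv ℝ Q y v := by
    intro v
    have : HasCompactSupport fun y => φ y ^ 2 * Q y := hsq.mul_right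
    exact this.mul_right
  have i4 : ∀ v, Integrable fun x => fderiv ℝ (fun y => φ y ^ 2 * Q y * fderiv ℝ Q y v) x v :=
    fun v => Continuous.integrable_of_hasCompactSupport
      (((hc v).continuous_fderiv one_ne_zero).clm_apply continuous_const)
      ((hcs v).fderiv_apply ℝ v)
  have i5 : Integrable fun x => φ x ^ 2 * (Q x ^ 4 - Q x ^ 2) := by
    simp only [mul_sub]
    exact i2.sub i3
  have hprod : ContDiff ℝ 1 fun y => φ y * Q y := hφ.mul hQ1
  have hps : HasCompactSupport fun y => φ y * Q y := hs.mul_right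
  have s2 : HasCompactSupport fun x => ‖fderiv ℝ (fun y => φ y * Q y) x‖ ^ 2 :=
    (hps.fderiv ℝ).comp_left (g := fun L : Plane →L[ℝ] ℝ => ‖L‖ ^ 2) (by simp)
  refine ⟨⟨hprod.differentiable one_ne_zero, hps, ?_⟩, i1, i2, i3, ?_⟩
  · exact Continuous.integrable_of_hasCompactSupport
      ((hprod.continuous_fderiv one_ne_zero).norm.pow 2) s2
  · have e : ∫ x, ‖fderiv ℝ (fun y => φ y * Q y) x‖ ^ 2 =
        ∫ x, (‖fderiv ℝ φ x‖ ^ 2 * Q x ^ 2 + φ x ^ 2 * (Q x ^ 4 - Q x ^ 2) +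
        (fderiv ℝ (fun y => φ y ^ 2 * Q y * fderiv ℝ Q y e0) x e0 +
          fderiv ℝ (fun y => φ y ^ 2 * Q y * fderiv ℝ Q y e1) x e1)) :=
      integral_congr_ae (ae_of_all _ fun x => hQ.norm_fderiv_mul_sq hd x)
    have e2 : ∫ x, φ x ^ 2 * (Q x ^ 4 - Q x ^ 2) =
        (∫ x, φ x ^ 2 * Q x ^ 4) - ∫ x, φ x ^ 2 * Q x ^ 2 := by
      rw [← integral_sub i2 i3]
      simp only [mul_sub]
    have i6 := i1.add i5
    have i7 := (i4 e0).add (i4 e1)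
    simp only [Pi.add_def] at i6 i7
    rw [e, integral_add i6 i7, integral_add i1 i5, integral_add (i4 e0) (i4 e1),
      integral_fderiv_eq_zero (hc e0) (hcs e0),
      integral_fderiv_eq_zero (hc e1) (hcs e1), e2]
    ring

theorem exists_tail_pow_four_le : ∃ ρ : ℝ, 0 ≤ ρ ∧
    ∫ x, indicator {x : Plane | ρ < ‖x‖} (fun x => Q x ^ 4) x ≤ 1 / 2 := by
  have ht : Tendsto (fun n : ℕ => ∫ x, indicator {x : Plane | (n : ℝ) < ‖x‖} (fun x => Q x ^ 4) x)
      atTop (𝓝 (∫ _ : Plane, (0 : ℝ))) := by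
    refine tendsto_integral_of_dominated_convergence (fun x => Q x ^ 4) (fun n => ?_)
      hQ.integrable_pow_four (fun n => ae_of_all _ fun x => ?_) (ae_of_all _ fun x => ?_)
    · exact ((hQ.continuous.pow 4).aestronglyMeasurable).indicator
        (measurableSet_lt measurable_const measurable_norm)
    · refine (norm_indicator_le_norm_self _ _).trans_eq ?_
      rw [Real.norm_of_nonneg (by positivity)]
    · refine tendsto_const_nhds.congr' ?_
      filter_upwards [eventually_ge_atTop ⌈‖x‖⌉₊] with n hn
      rw [indicator_of_notMem]
      simpa using Nat.ceil_le.1 hn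
  rw [integral_zero] at ht
  obtain ⟨n, hn⟩ := (ht.eventually (ge_mem_nhds (by norm_num : (0 : ℝ) < 1 / 2))).exists
  exact ⟨n, n.cast_nonneg, hn⟩

theorem exists_integral_mul_sq_le (C : ℝ) : ∃ B : ℝ, ∀ φ : Plane → ℝ, ContDiff ℝ 1 φ →
    HasCompactSupport φ → (∀ x, ‖fderiv ℝ φ x‖ ^ 2 ≤ C) → (∀ x, φ x ^ 2 ≤ ‖x‖ ^ 2) →
    ∫ x, φ x ^ 2 * Q x ^ 2 ≤ B := by
  obtain ⟨ρ, hρ, htail⟩ := hQ.exists_tail_pow_four_le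
  refine ⟨4 * (C * (∫ x, Q x ^ 2) + ρ ^ 2 * (∫ x, Q x ^ 4) + 1), fun φ hφ hs hC hle => ?_⟩
  obtain ⟨ht, i1, i2, i3, heq⟩ := hQ.integral_norm_fderiv_mul_sq hφ hs
  set A := ∫ x, φ x ^ 2 * Q x ^ 2
  set D := ∫ x, ‖fderiv ℝ (fun y => φ y * Q y) x‖ ^ 2
  have hA : 0 ≤ A := integral_nonneg fun x => by positivity
  have hD : 0 ≤ D := integral_nonneg fun x => by positivity
  set S := A + D + 1 with hS
  have hS1 : 1 ≤ S := by linarith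
  have e4 : ∀ x, |φ x * Q x| ^ 4 = (φ x * Q x) ^ 4 := fun x => Even.pow_abs ⟨2, rfl⟩ _
  have hlad : ∫ x, (φ x * Q x) ^ 4 ≤ (A + D) ^ 2 := by
    have h := ht.inH1.integrable_pow_four.2
    have hsum : ∫ x, (‖((φ x * Q x : ℝ) : ℂ)‖ ^ 2 +
        gradSq (fun y => ((φ y * Q y : ℝ) : ℂ)) x) = A + D := by
      simp only [gradSq_ofReal ht.diff, Complex.norm_real, Real.norm_eq_abs, sq_abs, mul_pow]
      exact integral_add i3 ht.grad
    rw [hsum] at h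
    simpa only [Complex.norm_real, Real.norm_eq_abs, e4] using h
  have h1 : ∫ x, ‖fderiv ℝ φ x‖ ^ 2 * Q x ^ 2 ≤ C * ∫ x, Q x ^ 2 := by
    rw [← integral_const_mul]
    exact integral_mono i1 (hQ.integrable_sq.const_mul C)
      fun x => mul_le_mul_of_nonneg_right (hC x) (sq_nonneg _)
  have hind : Integrable (indicator {x : Plane | ρ < ‖x‖} (fun x => Q x ^ 4)) :=
    hQ.integrable_pow_four.indicator (measurableSet_lt measurable_const measurable_norm)
  have i4 : Integrable fun x => (φ x * Q x) ^ 4 := ht.integrable_pow four_ne_zero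
  have j1 := hQ.integrable_pow_four.const_mul (ρ ^ 2)
  have j2 := i4.const_mul (1 / (2 * S))
  have j3 := hind.const_mul (S / 2)
  have j12 := j1.add j2
  simp only [Pi.add_def] at j12
  have h2 : ∫ x, φ x ^ 2 * Q x ^ 4 ≤ ρ ^ 2 * (∫ x, Q x ^ 4) +
      1 / (2 * S) * (∫ x, (φ x * Q x) ^ 4) +
      S / 2 * ∫ x, indicator {x : Plane | ρ < ‖x‖} (fun x => Q x ^ 4) x := by
    rw [← integral_const_mul, ← integral_const_mul, ← integral_const_mul, ← integral_add j1 j2,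
      ← integral_add j12 j3]
    refine integral_mono i2 (j12.add j3) fun x => ?_
    simp only
    have hp : 0 ≤ 1 / (2 * S) * (φ x * Q x) ^ 4 := by positivity
    rcases le_or_gt ‖x‖ ρ with hx | hx
    · rw [indicator_of_notMem (by simpa using hx)]
      have : φ x ^ 2 ≤ ρ ^ 2 := (hle x).trans (pow_le_pow_left₀ (norm_nonneg _) hx 2)
      have := mul_le_mul_of_nonneg_right this (by positivity : 0 ≤ Q x ^ 4)
      linarith
    · rw [indicator_of_mem (show x ∈ {x : Plane | ρ < ‖x‖} from hx)]
      have h0 : 0 ≤ ρ ^ 2 * Q x ^ 4 := by positivity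
      have key : φ x ^ 2 * Q x ^ 4 ≤ 1 / (2 * S) * (φ x * Q x) ^ 4 + S / 2 * Q x ^ 4 := by
        have hSp : 0 < S := by linarith
        have : 1 / (2 * S) * (φ x * Q x) ^ 4 + S / 2 * Q x ^ 4 - φ x ^ 2 * Q x ^ 4 =
            1 / (2 * S) * Q x ^ 4 * (φ x ^ 2 - S) ^ 2 := by
          field_simp
          ring
        have h3 : 0 ≤ 1 / (2 * S) * Q x ^ 4 * (φ x ^ 2 - S) ^ 2 := by positivity
        linarith
      linarith
  have h3 : 1 / (2 * S) * (∫ x, (φ x * Q x) ^ 4) ≤ S / 2 := by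
    rw [one_div, inv_mul_le_iff₀ (by linarith)]
    nlinarith
  have h4 : S / 2 * ∫ x, indicator {x : Plane | ρ < ‖x‖} (fun x => Q x ^ 4) x ≤ S / 4 := by
    nlinarith
  linarith

theorem integrable_mul_sq_of_norm_le_one (L : Plane →L[ℝ] ℝ) (hL : ‖L‖ ≤ 1) :
    Integrable fun x => L x ^ 2 * Q x ^ 2 := by
  obtain ⟨χ, K, hχ⟩ := exists_isCutoff
  have hK := hχ.const_nonneg
  obtain ⟨B, hB⟩ := hQ.exists_integral_mul_sq_le ((1 + K) ^ 2)
  have hLx : ∀ x, |L x| ≤ ‖x‖ := fun x => by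
    simpa using L.le_of_opNorm_le hL x
  have hc : Continuous fun x => L x ^ 2 * Q x ^ 2 := (L.continuous.pow 2).mul (hQ.continuous.pow 2)
  have hr : Tendsto (fun n : ℕ => ((n : ℝ) + 1) / 2) atTop atTop :=
    (tendsto_atTop_add_const_right _ 1 tendsto_natCast_atTop_atTop).atTop_div_const two_pos
  refine (aecover_closedBall (x := (0 : Plane)) hr).integrable_of_integral_bounded_of_nonneg_ae B
    (fun n => hc.continuousOn.integrableOn_compact (isCompact_closedBall _ _))
    (ae_of_all _ fun x => by positivity) (Eventually.of_forall fun n => ?_)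
  have hR : (0 : ℝ) < (n : ℝ) + 1 := by positivity
  set R : ℝ := (n : ℝ) + 1
  set φ : Plane → ℝ := fun x => L x * χ (R⁻¹ • x) with hφ
  have hχ1 := (hχ.contDiff_dilate R).of_le (by norm_num : (1 : WithTop ℕ∞) ≤ 2)
  have hφc : ContDiff ℝ 1 φ := L.contDiff.mul hχ1
  have hφs : HasCompactSupport φ := (hχ.hasCompactSupport_dilate hR).mul_left
  have hχd := hχ1.differentiable one_ne_zero
  have hgrad : ∀ x, ‖fderiv ℝ φ x‖ ≤ 1 + K := by
    intro x
    rw [hφ, fderiv_fun_mul L.differentiableAt (hχd x), L.fderiv]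
    have hχle : ‖χ (R⁻¹ • x) • L‖ ≤ 1 := by
      rw [norm_smul, Real.norm_of_nonneg (hχ.nonneg _)]
      exact mul_le_one₀ (hχ.le_one _) (norm_nonneg _) hL
    have h2 : ‖L x • fderiv ℝ (fun y => χ (R⁻¹ • y)) x‖ ≤ K := by
      rw [norm_smul, Real.norm_eq_abs]
      rcases le_or_gt ‖x‖ R with hx | hx
      · calc _ ≤ R * (K / R) := mul_le_mul ((hLx x).trans hx) (hχ.norm_fderiv_dilate_le hR x)
              (norm_nonneg _) hR.le
          _ = K := by field_simp
      · rw [hχ.fderiv_dilate_eq_zero_of_gt hR hx]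
        simpa using hK
    refine (norm_add_le _ _).trans ?_
    linarith
  have hi := (hQ.integral_norm_fderiv_mul_sq hφc hφs).2.2.2.1
  refine le_trans ?_ (hB φ hφc hφs (fun x => pow_le_pow_left₀ (norm_nonneg _) (hgrad x) 2) ?_)
  · rw [← integral_indicator isClosed_closedBall.measurableSet]
    refine integral_mono ((hc.continuousOn.integrableOn_compact
      (isCompact_closedBall _ _)).integrable_indicator isClosed_closedBall.measurableSet) hi
      fun x => ?_
    by_cases hx : x ∈ closedBall (0 : Plane) (R / 2)
    · have : χ (R⁻¹ • x) = 1 := hχ.dilate_eq_one hR (by simpa using hx)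
      rw [indicator_of_mem hx]
      simp [hφ, this]
    · rw [indicator_of_notMem hx]
      positivity
  · intro x
    rw [← sq_abs]
    refine pow_le_pow_left₀ (abs_nonneg _) ?_ 2
    rw [hφ, abs_mul, abs_of_nonneg (hχ.nonneg _)]
    exact (mul_le_of_le_one_right (abs_nonneg _) (hχ.le_one _)).trans (hLx x)

theorem integrable_norm_sq_mul_sq : Integrable fun x => ‖x‖ ^ 2 * Q x ^ 2 := by
  have h : ∀ i : Fin 2, Integrable fun x : Plane => x i ^ 2 * Q x ^ 2 := fun i => by
    refine hQ.integrable_mul_sq_of_norm_le_one (EuclideanSpace.proj i)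
      (ContinuousLinearMap.opNorm_le_bound _ zero_le_one fun x => ?_)
    rw [one_mul]
    exact PiLp.norm_apply_le x i
  have := (h 0).add (h 1)
  refine this.congr (ae_of_all _ fun x => ?_)
  simp only [Pi.add_apply]
  rw [norm_sq_eq_coords]
  ring

end IsGroundState

/-- The component along `v = e_i` of the vector field of the Pohozaev identity. -/
def pohozaevField (Q : Plane → ℝ) (i : Fin 2) (v x : Plane) : ℝ :=
  fderiv ℝ Q x v * (x 0 * fderiv ℝ Q x e0 + x 1 * fderiv ℝ Q x e1) -
    x i * ((fderiv ℝ Q x e0 ^ 2 + fderiv ℝ Q x e1 ^ 2) / 2 + Q x ^ 2 / 2 - Q x ^ 4 / 4)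

namespace IsGroundState

variable {Q : Plane → ℝ} (hQ : IsGroundState Q)
include hQ

theorem fderiv_fderiv_comm (x : Plane) :
    fderiv ℝ (fun y => fderiv ℝ Q y e0) x e1 = fderiv ℝ (fun y => fderiv ℝ Q y e1) x e0 := by
  have hs := (hQ.contDiff.contDiffAt (x := x)).isSymmSndFDerivAt (by simp)
  have hd : DifferentiableAt ℝ (fderiv ℝ Q) x :=
    (hQ.contDiff.fderiv_right (m := 1) (by norm_num)).differentiable one_ne_zero x
  have h : ∀ v w, fderiv ℝ (fun y => fderiv ℝ Q y v) x w = fderiv ℝ (fderiv ℝ Q) x w v := by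
    intro v w
    have := (hd.hasFDerivAt.clm_apply (hasFDerivAt_const v x)).fderiv
    rw [this]
    simp
  rw [h, h]
  exact hs.eq _ _

theorem contDiff_pohozaevField (i : Fin 2) (v : Plane) : ContDiff ℝ 1 (pohozaevField Q i v) := by
  have hc : ∀ j : Fin 2, ContDiff ℝ 1 fun x : Plane => x j := fun j =>
    (EuclideanSpace.proj (𝕜 := ℝ) j : Plane →L[ℝ] ℝ).contDiff
  have hQ1 : ContDiff ℝ 1 Q := hQ.contDiff.of_le (by norm_num)
  have p := hQ.contDiff_fderiv_apply
  exact ((p v).mul (((hc 0).mul (p e0)).add ((hc 1).mul (p e1)))).sub ((hc i).mul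
    (((((p e0).pow 2).add ((p e1).pow 2)).div_const 2).add ((hQ1.pow 2).div_const 2) |>.sub
      ((hQ1.pow 4).div_const 4)))

theorem fderiv_pohozaevField (i : Fin 2) (v w x : Plane) :
    fderiv ℝ (pohozaevField Q i v) x w =
      fderiv ℝ (fun y => fderiv ℝ Q y v) x w * (x 0 * fderiv ℝ Q x e0 + x 1 * fderiv ℝ Q x e1) +
      fderiv ℝ Q x v * (w 0 * fderiv ℝ Q x e0 + x 0 * fderiv ℝ (fun y => fderiv ℝ Q y e0) x w +
        (w 1 * fderiv ℝ Q x e1 + x 1 * fderiv ℝ (fun y => fderiv ℝ Q y e1) x w)) -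
      w i * ((fderiv ℝ Q x e0 ^ 2 + fderiv ℝ Q x e1 ^ 2) / 2 + Q x ^ 2 / 2 - Q x ^ 4 / 4) -
      x i * (fderiv ℝ Q x e0 * fderiv ℝ (fun y => fderiv ℝ Q y e0) x w +
        fderiv ℝ Q x e1 * fderiv ℝ (fun y => fderiv ℝ Q y e1) x w +
        (Q x - Q x ^ 3) * fderiv ℝ Q x w) := by
  have hc : ∀ j : Fin 2, HasFDerivAt (fun x : Plane => x j)
      (EuclideanSpace.proj (𝕜 := ℝ) j : Plane →L[ℝ] ℝ) x := fun j =>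
    (EuclideanSpace.proj (𝕜 := ℝ) j : Plane →L[ℝ] ℝ).hasFDerivAt
  have q := hQ.hasFDerivAt x
  have p := fun v => hQ.hasFDerivAt_fderiv_apply v x
  have := (((p v).mul (((hc 0).mul (p e0)).add ((hc 1).mul (p e1)))).sub ((hc i).mul
    ((((((p e0).pow 2).add ((p e1).pow 2)).mul_const (1 / 2)).add ((q.pow 2).mul_const (1 / 2))).sub
      ((q.pow 4).mul_const (1 / 4))))).fderiv
  have h2 := congrArg (fun L : Plane →L[ℝ] ℝ => L w) this
  simp only [_root_.add_apply, _root_.smul_apply, _root_.sub_apply, smul_eq_mul, Pi.mul_apply,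
    Pi.add_apply, Pi.sub_apply, PiLp.proj_apply] at h2
  refine Eq.trans ?_ (h2.trans ?_)
  · congr 2
    funext y
    simp only [pohozaevField, Pi.mul_apply, Pi.add_apply, Pi.sub_apply]
    ring
  · norm_num
    ring

theorem divergence_pohozaevField (x : Plane) :
    fderiv ℝ (pohozaevField Q 0 e0) x e0 + fderiv ℝ (pohozaevField Q 1 e1) x e1 =
      Q x ^ 4 / 2 - Q x ^ 2 := by
  rw [hQ.fderiv_pohozaevField, hQ.fderiv_pohozaevField]
  have h00 : (e0 : Plane) 0 = 1 := by simp [e0]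
  have h01 : (e0 : Plane) 1 = 0 := by simp [e0]
  have h10 : (e1 : Plane) 0 = 0 := by simp [e1]
  have h11 : (e1 : Plane) 1 = 1 := by simp [e1]
  rw [h00, h01, h10, h11, hQ.fderiv_fderiv_comm x]
  have h := hQ.equation x
  linear_combination (x 0 * fderiv ℝ Q x e0 + x 1 * fderiv ℝ Q x e1) * h

omit hQ in
theorem abs_pohozaevField_le (i : Fin 2) {v : Plane} (hv : ‖v‖ ≤ 1) (x : Plane) :
    |pohozaevField Q i v x| ≤ ‖x‖ * (3 * ‖fderiv ℝ Q x‖ ^ 2 + Q x ^ 2 + Q x ^ 4) := by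
  set G := ‖fderiv ℝ Q x‖
  have hG : 0 ≤ G := norm_nonneg _
  have h1 : |fderiv ℝ Q x v| ≤ G := by
    have := (fderiv ℝ Q x).le_opNorm_of_le hv
    simpa using this
  have hX : x 0 * fderiv ℝ Q x e0 + x 1 * fderiv ℝ Q x e1 = fderiv ℝ Q x x := by
    have := congrArg (fderiv ℝ Q x) (eq_smul_e0_add_smul_e1 x)
    rw [this, map_add, map_smul, map_smul, smul_eq_mul, smul_eq_mul]
  have h2 : |fderiv ℝ Q x x| ≤ G * ‖x‖ := (fderiv ℝ Q x).le_opNorm x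
  have h3 : |x i| ≤ ‖x‖ := PiLp.norm_apply_le x i
  have hx := norm_nonneg x
  rw [pohozaevField, hX, ← norm_dual_sq]
  refine (abs_sub _ _).trans ?_
  rw [abs_mul, abs_mul]
  have h4 : |G ^ 2 / 2 + Q x ^ 2 / 2 - Q x ^ 4 / 4| ≤ G ^ 2 + Q x ^ 2 + Q x ^ 4 := by
    have := pow_nonneg hG 2
    have := sq_nonneg (Q x)
    have : 0 ≤ Q x ^ 4 := by positivity
    rw [abs_le]
    constructor <;> linarith
  have h5 := mul_le_mul h1 h2 (abs_nonneg _) hG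
  have h6 := mul_le_mul h3 h4 (abs_nonneg _) hx
  nlinarith [mul_nonneg hx (sq_nonneg G)]

theorem pohozaev : ∫ x, Q x ^ 4 = 2 * ∫ x, Q x ^ 2 := by
  obtain ⟨χ, K, hχ⟩ := exists_isCutoff
  have hK := hχ.const_nonneg
  have hR : ∀ n : ℕ, (0 : ℝ) < (n : ℝ) + 1 := fun n => by positivity
  have hχ1 : ∀ n : ℕ, ContDiff ℝ 1 fun x => χ (((n : ℝ) + 1)⁻¹ • x) := fun n =>
    (hχ.contDiff_dilate _).of_le (by norm_num)
  have he0 : ‖e0‖ ≤ 1 := by simp [e0]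
  have he1 : ‖e1‖ ≤ 1 := by simp [e1]
  have hsmall : ∀ (n : ℕ) (i : Fin 2) (v x : Plane), ‖v‖ ≤ 1 →
      |pohozaevField Q i v x * fderiv ℝ (fun y => χ (((n : ℝ) + 1)⁻¹ • y)) x v| ≤
        K * (3 * ‖fderiv ℝ Q x‖ ^ 2 + Q x ^ 2 + Q x ^ 4) := by
    intro n i v x hv
    have hP : 0 ≤ 3 * ‖fderiv ℝ Q x‖ ^ 2 + Q x ^ 2 + Q x ^ 4 := by positivity
    rcases le_or_gt ‖x‖ ((n : ℝ) + 1) with hx | hx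
    · have h1 : |fderiv ℝ (fun y => χ (((n : ℝ) + 1)⁻¹ • y)) x v| ≤ K / ((n : ℝ) + 1) := by
        have := ContinuousLinearMap.le_of_opNorm_le_of_le _
          (hχ.norm_fderiv_dilate_le (hR n) x) hv
        simpa using this
      rw [abs_mul]
      refine (mul_le_mul (abs_pohozaevField_le i hv x) h1 (abs_nonneg _) (by positivity)).trans ?_
      have : ‖x‖ * (K / ((n : ℝ) + 1)) ≤ K := by
        rw [mul_div_assoc', div_le_iff₀ (hR n)]
        nlinarith
      nlinarith
    · rw [hχ.fderiv_dilate_eq_zero_of_gt (hR n) hx]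
      simp only [_root_.zero_apply, mul_zero, abs_zero]
      positivity
  set f : ℕ → Plane → ℝ := fun n x =>
    fderiv ℝ (fun y => χ (((n : ℝ) + 1)⁻¹ • y) * pohozaevField Q 0 e0 y) x e0 +
      fderiv ℝ (fun y => χ (((n : ℝ) + 1)⁻¹ • y) * pohozaevField Q 1 e1 y) x e1 with hf
  have hcd : ∀ (n : ℕ) (i : Fin 2) (v : Plane),
      ContDiff ℝ 1 fun y => χ (((n : ℝ) + 1)⁻¹ • y) * pohozaevField Q i v y := fun n i v =>
    (hχ1 n).mul (hQ.contDiff_pohozaevField i v)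
  have hcs : ∀ (n : ℕ) (i : Fin 2) (v : Plane),
      HasCompactSupport fun y => χ (((n : ℝ) + 1)⁻¹ • y) * pohozaevField Q i v y := fun n i v =>
    (hχ.hasCompactSupport_dilate (hR n)).mul_right
  have hcont : ∀ (n : ℕ) (i : Fin 2) (v : Plane), Continuous fun x =>
      fderiv ℝ (fun y => χ (((n : ℝ) + 1)⁻¹ • y) * pohozaevField Q i v y) x v := fun n i v =>
    ((hcd n i v).continuous_fderiv one_ne_zero).clm_apply continuous_const
  have hint : ∀ (n : ℕ) (i : Fin 2) (v : Plane), Integrable fun x =>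
      fderiv ℝ (fun y => χ (((n : ℝ) + 1)⁻¹ • y) * pohozaevField Q i v y) x v := fun n i v =>
    Continuous.integrable_of_hasCompactSupport (hcont n i v) ((hcs n i v).fderiv_apply ℝ v)
  have hf0 : ∀ n, ∫ x, f n x = 0 := by
    intro n
    rw [hf, integral_add (hint n 0 e0) (hint n 1 e1), integral_fderiv_eq_zero (hcd n 0 e0)
      (hcs n 0 e0), integral_fderiv_eq_zero (hcd n 1 e1) (hcs n 1 e1), add_zero]
  have hfe : ∀ n x, f n x = χ (((n : ℝ) + 1)⁻¹ • x) * (Q x ^ 4 / 2 - Q x ^ 2) +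
      (pohozaevField Q 0 e0 x * fderiv ℝ (fun y => χ (((n : ℝ) + 1)⁻¹ • y)) x e0 +
        pohozaevField Q 1 e1 x * fderiv ℝ (fun y => χ (((n : ℝ) + 1)⁻¹ • y)) x e1) := by
    intro n x
    have hd := (hχ1 n).differentiable one_ne_zero x
    have h1 : ∀ (i : Fin 2) (v : Plane),
        fderiv ℝ (fun y => χ (((n : ℝ) + 1)⁻¹ • y) * pohozaevField Q i v y) x v =
        χ (((n : ℝ) + 1)⁻¹ • x) * fderiv ℝ (pohozaevField Q i v) x v +
        pohozaevField Q i v x * fderiv ℝ (fun y => χ (((n : ℝ) + 1)⁻¹ • y)) x v := by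
      intro i v
      rw [fderiv_fun_mul hd ((hQ.contDiff_pohozaevField i v).differentiable one_ne_zero x)]
      rfl
    simp only [hf, h1, ← hQ.divergence_pohozaevField x]
    ring
  have hlim : Tendsto (fun n => ∫ x, f n x) atTop (𝓝 (∫ x, (Q x ^ 4 / 2 - Q x ^ 2))) := by
    refine tendsto_integral_of_dominated_convergence
      (fun x => (Q x ^ 4 + Q x ^ 2) + 2 * K * (3 * ‖fderiv ℝ Q x‖ ^ 2 + Q x ^ 2 + Q x ^ 4))
      (fun n => ((hcont n 0 e0).add (hcont n 1 e1)).aestronglyMeasurable)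
      ((hQ.integrable_pow_four.add hQ.integrable_sq).add
        ((((hQ.integrable_grad_sq.const_mul 3).add hQ.integrable_sq).add
          hQ.integrable_pow_four).const_mul _))
      (fun n => ae_of_all _ fun x => ?_) (ae_of_all _ fun x => ?_)
    · rw [hfe, Real.norm_eq_abs]
      have a1 := hsmall n 0 e0 x he0
      have a2 := hsmall n 1 e1 x he1
      have a3 : |χ (((n : ℝ) + 1)⁻¹ • x) * (Q x ^ 4 / 2 - Q x ^ 2)| ≤ Q x ^ 4 + Q x ^ 2 := by
        rw [abs_mul, abs_of_nonneg (hχ.nonneg _)]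
        refine (mul_le_of_le_one_left (abs_nonneg _) (hχ.le_one _)).trans ?_
        have := sq_nonneg (Q x)
        have : 0 ≤ Q x ^ 4 := by positivity
        rw [abs_le]
        constructor <;> linarith
      refine (abs_add_le _ _).trans (add_le_add a3 ((abs_add_le _ _).trans ?_))
      linarith
    · refine tendsto_const_nhds.congr' ?_
      filter_upwards [eventually_ge_atTop ⌈2 * ‖x‖⌉₊] with n hn
      have hn' : 2 * ‖x‖ < (n : ℝ) + 1 := (Nat.ceil_le.1 hn).trans_lt (lt_add_one _)
      rw [hfe, hχ.fderiv_dilate_eq_zero_of_lt (hR n) (by linarith),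
        hχ.dilate_eq_one (hR n) (by linarith)]
      simp
  simp only [hf0] at hlim
  have h := tendsto_nhds_unique hlim tendsto_const_nhds
  rw [integral_sub (hQ.integrable_pow_four.div_const 2) hQ.integrable_sq, integral_div] at h
  linarith

end IsGroundState

theorem ae_fst_ne_snd : ∀ᵐ p : Plane × Plane, p.1 ≠ p.2 := by
  have hs : MeasurableSet {p : Plane × Plane | p.1 = p.2} :=
    measurableSet_eq_fun measurable_fst measurable_snd
  have h : ((volume : Measure Plane).prod volume) {p : Plane × Plane | p.1 = p.2} = 0 := by
    rw [Measure.measure_prod_null hs]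
    refine ae_of_all _ fun x => ?_
    have : Prod.mk x ⁻¹' {p : Plane × Plane | p.1 = p.2} = {x} := by
      ext y
      simp [eq_comm]
    simp only [this, Pi.zero_apply]
    exact measure_singleton x
  exact measure_eq_zero_iff_ae_notMem.1 h

namespace IsTrial

variable {w : Plane → ℝ} (h : IsTrial w)
include h

theorem integrable_norm_pow_mul (n : ℕ) : Integrable fun x => ‖x‖ ^ n * w x ^ 2 := by
  have hs : HasCompactSupport fun x => w x ^ 2 :=
    h.supp.comp_left (g := fun r : ℝ => r ^ 2) (by simp)
  exact Continuous.integrable_of_hasCompactSupport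
    ((continuous_norm.pow n).mul (h.diff.continuous.pow 2)) hs.mul_left

theorem logConv_le {R : ℝ} (hR : 0 < R) : logConv (fun x => (w x : ℂ)) ≤
    2 * (∫ x, w x ^ 2) * (R * ∫ x, ‖x‖ * w x ^ 2) - (∫ x, w x ^ 2) ^ 2 * Real.log R := by
  have h1 := h.integrable_pow two_ne_zero
  have h2 : Integrable fun x => (w x ^ 2) ^ 2 := by
    simpa only [← pow_mul] using h.integrable_pow (n := 2 * 2) (by norm_num)
  have hx : Integrable fun x => ‖x‖ * w x ^ 2 := by simpa using h.integrable_norm_pow_mul 1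
  have hint := (integrable_log_kernel (ρ := fun x => w x ^ 2) (h.diff.continuous.pow 2).measurable
    (fun x => sq_nonneg (w x)) h1 h2 (h.integrable_norm_pow_mul 2)).1
  have e : ∀ x, ‖(w x : ℂ)‖ ^ 2 = w x ^ 2 := fun x => by
    rw [Complex.norm_real, Real.norm_eq_abs, sq_abs]
  rw [logConv_eq_integral_prod (by simpa only [e] using hint)]
  simp only [e]
  have a1 : Integrable fun p : Plane × Plane => (‖p.1‖ * w p.1 ^ 2) * w p.2 ^ 2 := hx.mul_prod h1
  have a2 : Integrable fun p : Plane × Plane => w p.1 ^ 2 * (‖p.2‖ * w p.2 ^ 2) := h1.mul_prod hx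
  have a3 : Integrable fun p : Plane × Plane => w p.1 ^ 2 * w p.2 ^ 2 := h1.mul_prod h1
  have b1 := a1.const_mul R
  have b2 := a2.const_mul R
  have b3 := a3.const_mul (Real.log R)
  have b12 := b1.add b2
  simp only [Pi.add_def] at b12
  calc ∫ p : Plane × Plane, Real.log ‖p.1 - p.2‖ * w p.1 ^ 2 * w p.2 ^ 2
      ≤ ∫ p : Plane × Plane, (R * ((‖p.1‖ * w p.1 ^ 2) * w p.2 ^ 2) +
          R * (w p.1 ^ 2 * (‖p.2‖ * w p.2 ^ 2)) - Real.log R * (w p.1 ^ 2 * w p.2 ^ 2)) := by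
        refine integral_mono_ae hint (b12.sub b3) ?_
        filter_upwards [ae_fst_ne_snd] with p hp
        have hpos : 0 < ‖p.1 - p.2‖ := norm_pos_iff.2 (sub_ne_zero.2 hp)
        have h3 := Real.log_le_self (mul_pos hR hpos).le
        rw [Real.log_mul hR.ne' hpos.ne'] at h3
        have h4 := mul_le_mul_of_nonneg_left (norm_sub_le p.1 p.2) hR.le
        have h5 : Real.log ‖p.1 - p.2‖ ≤ R * ‖p.1‖ + R * ‖p.2‖ - Real.log R := by linarith
        have h6 := mul_le_mul_of_nonneg_right h5
          (mul_nonneg (sq_nonneg (w p.1)) (sq_nonneg (w p.2)))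
        linarith
    _ = _ := by
        rw [integral_sub b12 b3, integral_add b1 b2, integral_const_mul, integral_const_mul,
          integral_const_mul]
        have c1 : ∫ p : Plane × Plane, (‖p.1‖ * w p.1 ^ 2) * w p.2 ^ 2 =
            (∫ x, ‖x‖ * w x ^ 2) * ∫ x, w x ^ 2 :=
          integral_prod_mul (fun x : Plane => ‖x‖ * w x ^ 2) (fun x : Plane => w x ^ 2)
        have c2 : ∫ p : Plane × Plane, w p.1 ^ 2 * (‖p.2‖ * w p.2 ^ 2) =
            (∫ x, w x ^ 2) * ∫ x, ‖x‖ * w x ^ 2 :=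
          integral_prod_mul (fun x : Plane => w x ^ 2) (fun x : Plane => ‖x‖ * w x ^ 2)
        have c3 : ∫ p : Plane × Plane, w p.1 ^ 2 * w p.2 ^ 2 =
            (∫ x, w x ^ 2) * ∫ x, w x ^ 2 :=
          integral_prod_mul (fun x : Plane => w x ^ 2) (fun x : Plane => w x ^ 2)
        rw [c1, c2, c3]
        ring

omit h in
theorem logConv_const_mul (t : ℝ) : logConv (fun x => ((t * w x : ℝ) : ℂ)) =
    t ^ 4 * logConv (fun x => (w x : ℂ)) := by
  simp only [logConv, ← integral_const_mul]
  refine integral_congr_ae (ae_of_all _ fun x => integral_congr_ae (ae_of_all _ fun y => ?_))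
  simp only [Complex.norm_real, Real.norm_eq_abs, sq_abs]
  ring

theorem energy_const_mul {V : Plane → ℝ} (hV : V110 V) (Ω t : ℝ) :
    Ea V Ω (fun x => ((t * w x : ℝ) : ℂ)) =
      t ^ 2 * ((∫ x, ‖fderiv ℝ w x‖ ^ 2) + ∫ x, V x * w x ^ 2) +
      t ^ 4 / 2 * (logConv (fun x => (w x : ℂ)) - ∫ x, w x ^ 4) := by
  have e1 : ∫ x, V x * (t * w x) ^ 2 = t ^ 2 * ∫ x, V x * w x ^ 2 := by
    rw [← integral_const_mul]
    exact integral_congr_ae (ae_of_all _ fun x => by ring)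
  have e2 : ∫ x, (t * w x) ^ 4 = t ^ 4 * ∫ x, w x ^ 4 := by
    rw [← integral_const_mul]
    exact integral_congr_ae (ae_of_all _ fun x => by ring)
  rw [(h.const_mul t).energy_eq hV, h.integral_grad_const_mul, logConv_const_mul, e1, e2]
  ring

end IsTrial

theorem IsGroundState.exists_trial {Q : Plane → ℝ} (hQ : IsGroundState Q) {V : Plane → ℝ}
    (hV : V110 V) : ∃ C R₀ : ℝ, ∀ R, R₀ ≤ R → 0 < R → ∃ w, IsTrial w ∧
      (∫ x, Q x ^ 2) / 2 ≤ ∫ x, w x ^ 2 ∧ ∫ x, w x ^ 2 ≤ ∫ x, Q x ^ 2 ∧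
      (∫ x, ‖fderiv ℝ w x‖ ^ 2) - (∫ x, w x ^ 4) / 2 ≤ C ∧ (∫ x, V x * w x ^ 2) ≤ C ∧
      logConv (fun x => (w x : ℂ)) ≤ (∫ x, w x ^ 2) * C - (∫ x, w x ^ 2) ^ 2 * Real.log R := by
  obtain ⟨χ, K, hχ⟩ := exists_isCutoff
  obtain ⟨CV, hCV⟩ := hV.2.2.1 1
  set M := ∫ x, Q x ^ 2 with hM
  set M₂ := ∫ x, ‖x‖ ^ 2 * Q x ^ 2 with hM₂
  have hMpos : 0 < M := hQ.integral_sq_pos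
  have hM₂0 : 0 ≤ M₂ := integral_nonneg fun x => by positivity
  have iQ := hQ.integrable_sq
  have ixQ := hQ.integrable_norm_sq_mul_sq
  refine ⟨K ^ 2 * M + 4 * M₂ + |CV| * M + 2 * (M + M₂), Real.sqrt (8 * M₂ / M),
    fun R hR₀ hR => ?_⟩
  have hR2 : 8 * M₂ / M ≤ R ^ 2 := (Real.sqrt_le_left hR.le).1 hR₀
  have hχ1 : ContDiff ℝ 1 fun x => χ (R⁻¹ • x) := (hχ.contDiff_dilate _).of_le (by norm_num)
  obtain ⟨ht, i1, i2, i3, heq⟩ :=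
    hQ.integral_norm_fderiv_mul_sq hχ1 (hχ.hasCompactSupport_dilate hR)
  set w : Plane → ℝ := fun y => χ (R⁻¹ • y) * Q y with hw
  have hχ0 : ∀ x, 0 ≤ χ (R⁻¹ • x) := fun x => hχ.nonneg _
  have hχle : ∀ x, χ (R⁻¹ • x) ≤ 1 := fun x => hχ.le_one _
  have hχsq : ∀ x, χ (R⁻¹ • x) ^ 2 ≤ 1 := fun x => pow_le_one₀ (hχ0 x) (hχle x)
  have hwle : ∀ x, w x ^ 2 ≤ Q x ^ 2 := fun x => by
    simp only [hw, mul_pow]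
    exact mul_le_of_le_one_left (sq_nonneg _) (hχsq x)
  have hw2 : ∫ x, w x ^ 2 = ∫ x, χ (R⁻¹ • x) ^ 2 * Q x ^ 2 := by simp only [hw, mul_pow]
  have hb2 : ∫ x, w x ^ 2 ≤ M := integral_mono (ht.integrable_pow two_ne_zero) iQ hwle
  have hb1 : M - 4 / R ^ 2 * M₂ ≤ ∫ x, w x ^ 2 := by
    rw [hM, hM₂, ← integral_const_mul, ← integral_sub iQ (ixQ.const_mul _), hw2]
    refine integral_mono (iQ.sub (ixQ.const_mul _)) i3 fun x => ?_
    simp only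
    rcases le_or_gt ‖x‖ (R / 2) with hx | hx
    · rw [hχ.dilate_eq_one hR hx]
      have : 0 ≤ 4 / R ^ 2 * (‖x‖ ^ 2 * Q x ^ 2) := by positivity
      linarith
    · have h1 : 1 ≤ 4 / R ^ 2 * ‖x‖ ^ 2 := by
        rw [div_mul_eq_mul_div, le_div_iff₀ (by positivity)]
        nlinarith
      have := mul_le_mul_of_nonneg_right h1 (sq_nonneg (Q x))
      have : 0 ≤ χ (R⁻¹ • x) ^ 2 * Q x ^ 2 := by positivity
      linarith
  have hbhalf : M / 2 ≤ ∫ x, w x ^ 2 := by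
    have : 4 / R ^ 2 * M₂ ≤ M / 2 := by
      rw [div_le_iff₀ hMpos] at hR2
      rw [div_mul_eq_mul_div, div_le_iff₀ (by positivity)]
      linarith
    linarith
  have hgrad : ∫ x, ‖fderiv ℝ (fun y => χ (R⁻¹ • y)) x‖ ^ 2 * Q x ^ 2 ≤ (K / R) ^ 2 * M := by
    rw [hM, ← integral_const_mul]
    refine integral_mono i1 (iQ.const_mul _) fun x => ?_
    exact mul_le_mul_of_nonneg_right
      (pow_le_pow_left₀ (norm_nonneg _) (hχ.norm_fderiv_dilate_le hR x) 2) (sq_nonneg _)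
  have hquart : (∫ x, χ (R⁻¹ • x) ^ 2 * Q x ^ 4) - (∫ x, w x ^ 4) / 2 ≤ M := by
    have hp := hQ.pohozaev
    have i4 := (ht.integrable_pow four_ne_zero).div_const 2
    have : (∫ x, χ (R⁻¹ • x) ^ 2 * Q x ^ 4) - (∫ x, w x ^ 4) / 2 ≤ ∫ x, Q x ^ 4 / 2 := by
      rw [← integral_div, ← integral_sub i2 i4]
      refine integral_mono (i2.sub i4) (hQ.integrable_pow_four.div_const 2) fun x => ?_
      simp only [hw]
      have : 0 ≤ (χ (R⁻¹ • x) ^ 2 - 1) ^ 2 * Q x ^ 4 := by positivity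
      linarith
    rw [integral_div, hp] at this
    linarith
  have hbal : (∫ x, ‖fderiv ℝ w x‖ ^ 2) - (∫ x, w x ^ 4) / 2 ≤ (K ^ 2 * M + 4 * M₂) / R ^ 2 := by
    rw [heq, ← hw2]
    have : (K ^ 2 * M + 4 * M₂) / R ^ 2 = (K / R) ^ 2 * M + 4 / R ^ 2 * M₂ := by ring
    linarith
  have hd := ht.dilate hR
  have hmass : ∫ x, (R * w (R • x)) ^ 2 = ∫ x, w x ^ 2 := by
    simpa using IsTrial.integral_dilate_pow (w := w) hR 0
  have hquart' : ∫ x, (R * w (R • x)) ^ 4 = R ^ 2 * ∫ x, w x ^ 4 := IsTrial.integral_dilate_pow hR 2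
  have hCVM : 0 ≤ |CV| * M := by positivity
  have hKM : 0 ≤ K ^ 2 * M := by positivity
  refine ⟨_, hd, ?_, ?_, ?_, ?_, ?_⟩
  · rwa [hmass]
  · rwa [hmass]
  · rw [ht.integral_grad_dilate hR, hquart']
    have := (le_div_iff₀ (by positivity)).1 hbal
    linarith
  · have : ∫ x, V x * (R * w (R • x)) ^ 2 ≤ |CV| * ∫ x, w x ^ 2 := by
      rw [← hmass, ← integral_const_mul]
      refine integral_mono (hd.integrable_mul_pow hV two_ne_zero)
        ((hd.integrable_pow two_ne_zero).const_mul _) fun x => ?_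
      rcases le_or_gt ‖x‖ 1 with hx | hx
      · exact mul_le_mul_of_nonneg_right ((hCV x hx).trans (le_abs_self _)) (sq_nonneg _)
      · have h0 : χ (R⁻¹ • (R • x)) = 0 := by
          apply hχ.dilate_eq_zero hR
          rw [norm_smul, Real.norm_of_nonneg hR.le]
          nlinarith
        simp [hw, h0]
    have := mul_le_mul_of_nonneg_left hb2 (abs_nonneg CV)
    linarith
  · refine (hd.logConv_le hR).trans ?_
    rw [hmass]
    have hmom : R * ∫ x, ‖x‖ * (R * w (R • x)) ^ 2 = ∫ x, ‖x‖ * w x ^ 2 := by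
      have := Measure.integral_comp_smul (volume : Measure Plane) (fun x => ‖x‖ * w x ^ 2) R
      rw [finrank_euclideanSpace_fin, abs_of_nonneg (by positivity), smul_eq_mul] at this
      have e : ∀ x : Plane, R * (‖x‖ * (R * w (R • x)) ^ 2) = R ^ 2 * (‖R • x‖ * w (R • x) ^ 2) := by
        intro x
        rw [norm_smul, Real.norm_of_nonneg hR.le]
        ring
      rw [← integral_const_mul]
      simp only [e]
      rw [integral_const_mul, this]
      field_simp
    have hmom2 : ∫ x, ‖x‖ * w x ^ 2 ≤ M + M₂ := by
      rw [hM, hM₂, ← integral_add iQ ixQ]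
      refine integral_mono (by simpa using ht.integrable_norm_pow_mul 1) (iQ.add ixQ) fun x => ?_
      simp only
      have h1 : ‖x‖ ≤ 1 + ‖x‖ ^ 2 := by nlinarith [sq_nonneg (‖x‖ - 1), norm_nonneg x]
      have h2 := mul_le_mul h1 (hwle x) (sq_nonneg _) (by positivity)
      linarith
    rw [hmom]
    have hb0 : 0 ≤ ∫ x, w x ^ 2 := by linarith
    have h3 : 2 * (∫ x, ‖x‖ * w x ^ 2) ≤ K ^ 2 * M + 4 * M₂ + |CV| * M + 2 * (M + M₂) := by
      linarith
    have h4 := mul_le_mul_of_nonneg_left h3 hb0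
    linarith

theorem IsGroundState.eventually_energy_le {Q : Plane → ℝ} (hQ : IsGroundState Q) {V : Plane → ℝ}
    (hV : V110 V) (Ω B : ℝ) :
    ∀ᶠ a in 𝓝[<] (∫ x, Q x ^ 2), ∀ u, IsMinimizer V Ω a u → Ea V Ω u ≤ B := by
  obtain ⟨C, R₀, hC⟩ := hQ.exists_trial hV
  have hM := hQ.integral_sq_pos
  set M := ∫ x, Q x ^ 2
  set T := (4 * |C| + M * |C| - B + 1) / (M ^ 2 / 2) with hT
  have hRpos : 0 < max R₀ (Real.exp T) := lt_max_of_lt_right (Real.exp_pos _)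
  obtain ⟨w, hw, hb1, hb2, hD, hVw, hL⟩ := hC _ (le_max_left R₀ (Real.exp T)) hRpos
  have hlog : T ≤ Real.log (max R₀ (Real.exp T)) :=
    (Real.le_log_iff_exp_le hRpos).2 (le_max_right _ _)
  set b := ∫ x, w x ^ 2
  set D := ∫ x, ‖fderiv ℝ w x‖ ^ 2
  set F := ∫ x, w x ^ 4 with hF
  set W := ∫ x, V x * w x ^ 2
  set L := logConv fun x => (w x : ℂ)
  have hF0 : 0 ≤ F := integral_nonneg fun x => by positivity
  have hb : 0 < b := by linarith
  have hCabs := le_abs_self C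
  have hC0 := abs_nonneg C
  have hs1 : 1 ≤ M / b := (one_le_div hb).2 hb2
  have hs2 : M / b ≤ 2 := (div_le_iff₀ hb).2 (by linarith)
  have hsb : M / b * b = M := div_mul_cancel₀ _ hb.ne'
  set f : ℝ → ℝ := fun a => a / b * (D + W) + (a / b) ^ 2 / 2 * (L - F) with hf
  have hfc : Continuous f := by fun_prop
  have hfM : f M < B := by
    simp only [hf]
    set s := M / b
    have h1 : s * (D - F / 2) ≤ 2 * |C| := by nlinarith
    have h2 : s * W ≤ 2 * |C| := by nlinarith
    have h3 : s ^ 2 / 2 * L ≤ M * |C| - M ^ 2 / 2 * T := by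
      calc s ^ 2 / 2 * L
          ≤ s ^ 2 / 2 * (b * C - b ^ 2 * Real.log (max R₀ (Real.exp T))) :=
            mul_le_mul_of_nonneg_left hL (by positivity)
        _ = (s * b) * (s * C) / 2 - (s * b) ^ 2 / 2 * Real.log (max R₀ (Real.exp T)) := by ring
        _ ≤ M * |C| - M ^ 2 / 2 * T := by
            rw [hsb]
            have h4 : s * C ≤ 2 * |C| := by nlinarith
            have h5 := mul_le_mul_of_nonneg_left h4 hM.le
            have h6 := mul_le_mul_of_nonneg_left hlog (by positivity : 0 ≤ M ^ 2 / 2)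
            linarith
    have h4 : M ^ 2 / 2 * T = 4 * |C| + M * |C| - B + 1 := by
      rw [hT]
      field_simp
    have h5 : s * F ≤ s ^ 2 * F := by nlinarith [mul_nonneg (by linarith : 0 ≤ s) hF0]
    linarith
  have hev : ∀ᶠ a in 𝓝[<] M, f a < B :=
    (hfc.tendsto M).mono_left nhdsWithin_le_nhds |>.eventually (gt_mem_nhds hfM)
  have hpos : ∀ᶠ a in 𝓝[<] M, 0 < a := nhdsWithin_le_nhds (lt_mem_nhds hM)
  filter_upwards [hev, hpos] with a ha ha0 u hu
  refine (hu.2 _ (hw.const_mul_mem_Sset hV ha0 hb)).trans ?_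
  rw [hw.energy_const_mul hV]
  have ht2 : Real.sqrt (a / b) ^ 2 = a / b := Real.sq_sqrt (by positivity)
  have ht4 : Real.sqrt (a / b) ^ 4 = (a / b) ^ 2 := by
    rw [show Real.sqrt (a / b) ^ 4 = (Real.sqrt (a / b) ^ 2) ^ 2 by ring, ht2]
  rw [ht2, ht4]
  exact ha.le

theorem InH.integrable_norm_sq_mul {V : Plane → ℝ} {Ω : ℝ} (hΩ : 0 < Ω)
    (h0 : ∀ x, 0 ≤ V x - Ω ^ 2 / 4 * ‖x‖ ^ 2) {u : Plane → ℂ} (hu : InH V u) :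
    Integrable fun x => ‖x‖ ^ 2 * ‖u x‖ ^ 2 := by
  refine (hu.2.const_mul (4 / Ω ^ 2)).mono' (Continuous.aestronglyMeasurable
    ((continuous_norm.pow 2).mul (hu.1.1.continuous.norm.pow 2))) (ae_of_all _ fun x => ?_)
  rw [Real.norm_of_nonneg (by positivity), ← mul_assoc]
  refine mul_le_mul_of_nonneg_right ?_ (sq_nonneg _)
  rw [div_mul_eq_mul_div, le_div_iff₀ (by positivity)]
  linarith [h0 x]

theorem InH.integrable_momentum {V : Plane → ℝ} {Ω : ℝ} (hΩ : 0 < Ω)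
    (h0 : ∀ x, 0 ≤ V x - Ω ^ 2 / 4 * ‖x‖ ^ 2) {u : Plane → ℂ} (hu : InH V u) :
    Integrable (momentum u) := by
  refine ((hu.integrable_norm_sq_mul hΩ h0).add hu.1.2.2).mono' ?_ (ae_of_all _ fun x => ?_)
  · have hm : Measurable u := hu.1.1.continuous.measurable
    have m0 := measurable_d0 u
    have m1 := measurable_d1 u
    have mc : Measurable fun x => (starRingEnd ℂ) (u x) := Complex.continuous_conj.measurable.comp hm
    have c0 : Measurable fun x : Plane => x 0 :=
      (EuclideanSpace.proj (𝕜 := ℝ) (0 : Fin 2) : Plane →L[ℝ] ℝ).continuous.measurable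
    have c1 : Measurable fun x : Plane => x 1 :=
      (EuclideanSpace.proj (𝕜 := ℝ) (1 : Fin 2) : Plane →L[ℝ] ℝ).continuous.measurable
    exact ((c1.neg.mul (Complex.measurable_im.comp (mc.mul m0))).add
      (c0.mul (Complex.measurable_im.comp (mc.mul m1)))).aestronglyMeasurable
  · have hb : ∀ z : ℂ, |((starRingEnd ℂ) (u x) * z).im| ≤ ‖u x‖ * ‖z‖ := fun z => by
      refine (Complex.abs_im_le_norm _).trans_eq ?_
      rw [norm_mul, RCLike.norm_conj]
    have h1 : |x 0| ≤ ‖x‖ := PiLp.norm_apply_le x 0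
    have h2 : |x 1| ≤ ‖x‖ := PiLp.norm_apply_le x 1
    have h3 := mul_le_mul h2 (hb (d0 u x)) (abs_nonneg _) (norm_nonneg _)
    have h4 := mul_le_mul h1 (hb (d1 u x)) (abs_nonneg _) (norm_nonneg _)
    simp only [Pi.add_apply, gradSq, momentum, Real.norm_eq_abs]
    refine (abs_add_le _ _).trans ?_
    rw [abs_mul, abs_mul, abs_neg]
    nlinarith [sq_nonneg (‖x‖ * ‖u x‖ / 2 - ‖d0 u x‖), sq_nonneg (‖x‖ * ‖u x‖ / 2 - ‖d1 u x‖),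
      sq_nonneg (‖x‖ * ‖u x‖)]

theorem InH.energy_ge {V : Plane → ℝ} {Ω : ℝ} (hΩ : 0 < Ω)
    (h0 : ∀ x, 0 ≤ V x - Ω ^ 2 / 4 * ‖x‖ ^ 2) {u : Plane → ℂ} (hu : InH V u) :
    (∫ x, gradAbsSq u x) + (∫ x, (V x - Ω ^ 2 / 4 * ‖x‖ ^ 2) * ‖u x‖ ^ 2) +
      (∫ p, kerPos (fun x => ‖u x‖ ^ 2) p) / 2 - (∫ p, kerNeg (fun x => ‖u x‖ ^ 2) p) / 2 -
      (∫ x, ‖u x‖ ^ 4) / 2 ≤ Ea V Ω u := by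
  have ix := hu.integrable_norm_sq_mul hΩ h0
  have im := hu.integrable_momentum hΩ h0
  have h4 : Integrable fun x => (‖u x‖ ^ 2) ^ 2 := by
    simpa only [← pow_mul] using hu.1.integrable_pow_four.1
  obtain ⟨hi, hlog⟩ := integrable_log_kernel (ρ := fun x => ‖u x‖ ^ 2)
    (hu.1.1.continuous.norm.pow 2).measurable (fun x => sq_nonneg _) hu.1.2.1 h4 ix
  have hg : ∫ x, gradAbsSq u x ≤ (∫ x, gradSq u x) - Ω * (∫ x, momentum u x) +
      Ω ^ 2 / 4 * ∫ x, ‖x‖ ^ 2 * ‖u x‖ ^ 2 := by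
    have j := hu.1.2.2.sub (im.const_mul Ω)
    simp only [Pi.sub_def] at j
    rw [← integral_const_mul, ← integral_const_mul, ← integral_sub hu.1.2.2 (im.const_mul Ω),
      ← integral_add j (ix.const_mul _)]
    refine integral_mono hu.1.integrable_gradAbsSq (j.add (ix.const_mul _)) fun x => ?_
    have := gradAbsSq_le hu.1.1 Ω x
    simp only
    linarith
  have hX : ∫ x, (V x - Ω ^ 2 / 4 * ‖x‖ ^ 2) * ‖u x‖ ^ 2 =
      (∫ x, V x * ‖u x‖ ^ 2) - Ω ^ 2 / 4 * ∫ x, ‖x‖ ^ 2 * ‖u x‖ ^ 2 := by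
    rw [← integral_const_mul, ← integral_sub hu.2 (ix.const_mul _)]
    exact integral_congr_ae (ae_of_all _ fun x => by ring)
  rw [Ea, integral_add hu.1.2.2 hu.2, logConv_eq_integral_prod hi, hlog, hX]
  linarith

/-- Deducing the blow-up rates from the energy inequalities. -/
theorem tendsto_of_energy_bounds {ι : Type*} {l : Filter ι} {G F X P N E : ι → ℝ} {A κ : ℝ}
    (hA : 0 < A) (hX : ∀ᶠ i in l, 0 ≤ X i) (hP : ∀ᶠ i in l, 0 ≤ P i) (hN : ∀ᶠ i in l, 0 ≤ N i)
    (hFG : ∀ᶠ i in l, F i ≤ 2 * G i)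
    (hNle : ∀ᶠ i in l, ∀ r, 0 < r → N i ≤ A * (A + r * κ + F i / r))
    (hle : ∀ᶠ i in l, G i + X i + P i / 2 - N i / 2 - F i / 2 ≤ E i)
    (hE : ∀ B, ∀ᶠ i in l, E i ≤ B) :
    Tendsto (fun i => (G i)⁻¹ * F i) l (𝓝 2) ∧ Tendsto (fun i => (G i)⁻¹ * X i) l (𝓝 0) ∧
    Tendsto (fun i => (G i)⁻¹ * P i) l (𝓝 0) ∧ Tendsto (fun i => (G i)⁻¹ * E i) l (𝓝 0) := by
  have hG : Tendsto G l atTop := by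
    rw [Filter.tendsto_atTop]
    intro T
    filter_upwards [hX, hP, hFG, hNle, hle, hE (-(A * (A + κ + 2 * T)) / 2)]
      with i h1 h2 h3 h4 h5 h6
    have h7 := h4 1 one_pos
    rw [div_one, one_mul] at h7
    have h8 : A * (A + κ + 2 * T) ≤ A * (A + κ + 2 * G i) := by
      have := mul_le_mul_of_nonneg_left h3 hA.le
      linarith
    have := le_of_mul_le_mul_left h8 hA
    linarith
  have hG0 : ∀ᶠ i in l, 0 < G i := hG.eventually_gt_atTop 0
  have hinv : Tendsto (fun i => (G i)⁻¹) l (𝓝 0) := tendsto_inv_atTop_zero.comp hG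
  have hsq : Tendsto (fun i => Real.sqrt (G i)⁻¹) l (𝓝 0) := by
    have := (Real.continuous_sqrt.tendsto 0).comp hinv
    rw [Real.sqrt_zero] at this
    exact this
  have hNG : Tendsto (fun i => (G i)⁻¹ * N i) l (𝓝 0) := by
    have hb : Tendsto (fun i => A * (A * (G i)⁻¹ + (κ + 2) * Real.sqrt (G i)⁻¹)) l (𝓝 0) := by
      simpa using ((hinv.const_mul A).add (hsq.const_mul (κ + 2))).const_mul A
    refine tendsto_of_tendsto_of_tendsto_of_le_of_le' tendsto_const_nhds hb ?_ ?_
    · filter_upwards [hG0, hN] with i h1 h2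
      positivity
    · filter_upwards [hG0, hFG, hNle] with i h1 h2 h3
      have hr : 0 < Real.sqrt (G i) := Real.sqrt_pos.2 h1
      have hrr : Real.sqrt (G i) ^ 2 = G i := Real.sq_sqrt h1.le
      have h4 := h3 _ hr
      rw [Real.sqrt_inv]
      set r := Real.sqrt (G i)
      have h5 : F i / r ≤ 2 * r := by
        rw [div_le_iff₀ hr]
        nlinarith
      have h6 : N i ≤ A * (A + r * κ + 2 * r) :=
        h4.trans (mul_le_mul_of_nonneg_left (by linarith) hA.le)
      refine (mul_le_mul_of_nonneg_left h6 (inv_nonneg.2 h1.le)).trans_eq ?_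
      rw [← hrr]
      field_simp
      ring
  have hE0 := hE 0
  refine ⟨?_, ?_, ?_, ?_⟩
  · refine tendsto_of_tendsto_of_tendsto_of_le_of_le' (g := fun i => 2 - (G i)⁻¹ * N i)
      (by simpa using tendsto_const_nhds.sub hNG) tendsto_const_nhds ?_ ?_
    · filter_upwards [hG0, hX, hP, hle, hE0] with i h1 h2 h3 h4 h5
      have : 2 * G i - N i ≤ F i := by linarith
      have := mul_le_mul_of_nonneg_left this (inv_nonneg.2 h1.le)
      have e : (G i)⁻¹ * (2 * G i - N i) = 2 - (G i)⁻¹ * N i := by field_simp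
      linarith
    · filter_upwards [hG0, hFG] with i h1 h2
      rw [inv_mul_le_iff₀ h1]
      linarith
  · refine tendsto_of_tendsto_of_tendsto_of_le_of_le' tendsto_const_nhds hNG ?_ ?_
    · filter_upwards [hG0, hX] with i h1 h2
      positivity
    · filter_upwards [hG0, hX, hP, hN, hFG, hle, hE0] with i h1 h2 h3 h4 h5 h6 h7
      exact mul_le_mul_of_nonneg_left (by linarith) (inv_nonneg.2 h1.le)
  · refine tendsto_of_tendsto_of_tendsto_of_le_of_le' tendsto_const_nhds hNG ?_ ?_
    · filter_upwards [hG0, hP] with i h1 h2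
      positivity
    · filter_upwards [hG0, hX, hFG, hle, hE0] with i h1 h2 h3 h4 h5
      exact mul_le_mul_of_nonneg_left (by linarith) (inv_nonneg.2 h1.le)
  · refine tendsto_of_tendsto_of_tendsto_of_le_of_le' (g := fun i => -((G i)⁻¹ * N i))
      (by simpa using hNG.neg) tendsto_const_nhds ?_ ?_
    · filter_upwards [hG0, hX, hP, hN, hFG, hle] with i h1 h2 h3 h4 h5 h6
      rw [← mul_neg]
      exact mul_le_mul_of_nonneg_left (by linarith) (inv_nonneg.2 h1.le)
    · filter_upwards [hG0, hE0] with i h1 h2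
      exact mul_nonpos_of_nonneg_of_nonpos (inv_nonneg.2 h1.le) h2

theorem sq_epsOf (u : ℝ → Plane → ℂ) (a : ℝ) :
    epsOf u a ^ 2 = (∫ x, gradAbsSq (u a) x)⁻¹ := by
  have h : 0 ≤ ∫ x, gradAbsSq (u a) x := integral_nonneg fun x => gradAbsSq_nonneg _ x
  rw [epsOf, ← Real.rpow_natCast, ← Real.rpow_mul h]
  norm_num
  rw [Real.rpow_neg_one]

theorem IsMinimizer.eInf_eq {V : Plane → ℝ} {Ω a : ℝ} {u : Plane → ℂ}
    (hu : IsMinimizer V Ω a u) : eInf V Ω a = Ea V Ω u := by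
  have : IsLeast (Ea V Ω '' Sset V a) (Ea V Ω u) :=
    ⟨⟨u, hu.1, rfl⟩, by rintro _ ⟨v, hv, rfl⟩; exact hu.2 v hv⟩
  exact this.csInf_eq

theorem rescaled_energy_limits
    (V : Plane → ℝ) (Ω α : ℝ) (Q : Plane → ℝ)
    (hV : V110 V) (hΩ : 0 < Ω) (hsub : SubCritical V Ω) (hCV : CondV V Ω α)
    (hQ : IsGroundState Q)
    (astar : ℝ) (hastar : astar = ∫ x : Plane, (Q x) ^ 2)
    (u : ℝ → Plane → ℂ)
    (hmin : ∀ a ∈ Ioo (0 : ℝ) astar, IsMinimizer V Ω a (u a))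
 :
    Tendsto (fun a => (epsOf u a) ^ 2 * ∫ x : Plane, ‖u a x‖ ^ 4) (𝓝[<] astar) (𝓝 2) ∧
    Tendsto (fun a => (epsOf u a) ^ 2 *
        ∫ x : Plane, (V x - Ω ^ 2 / 4 * ‖x‖ ^ 2) * ‖u a x‖ ^ 2) (𝓝[<] astar) (𝓝 0) ∧
    Tendsto (fun a => (epsOf u a) ^ 2 *
        ∫ x : Plane, ∫ y : Plane, Real.log (1 + ‖x - y‖) * ‖u a x‖ ^ 2 * ‖u a y‖ ^ 2)
      (𝓝[<] astar) (𝓝 0) ∧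
    Tendsto (fun a => (epsOf u a) ^ 2 * eInf V Ω a) (𝓝[<] astar) (𝓝 0) := by
  have hM : 0 < astar := hastar ▸ hQ.integral_sq_pos
  have hIoo : ∀ᶠ a in 𝓝[<] astar, a ∈ Ioo (0 : ℝ) astar := Ioo_mem_nhdsLT hM
  have h0 := hCV.2.1
  have hmem : ∀ a ∈ Ioo (0 : ℝ) astar, InH V (u a) ∧ ∫ x, ‖u a x‖ ^ 2 = a := fun a ha =>
    (hmin a ha).1
  have h4 : ∀ a ∈ Ioo (0 : ℝ) astar, Integrable fun x => (‖u a x‖ ^ 2) ^ 2 := fun a ha => by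
    simpa only [← pow_mul] using (hmem a ha).1.1.integrable_pow_four.1
  have hkey := tendsto_of_energy_bounds (l := 𝓝[<] astar)
    (G := fun a => ∫ x, gradAbsSq (u a) x) (F := fun a => ∫ x, ‖u a x‖ ^ 4)
    (X := fun a => ∫ x, (V x - Ω ^ 2 / 4 * ‖x‖ ^ 2) * ‖u a x‖ ^ 2)
    (P := fun a => ∫ p, kerPos (fun x => ‖u a x‖ ^ 2) p)
    (N := fun a => ∫ p, kerNeg (fun x => ‖u a x‖ ^ 2) p)
    (E := fun a => eInf V Ω a) (A := astar) (κ := ∫ z, singKernel z) hM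
    (Eventually.of_forall fun a => integral_nonneg fun x => mul_nonneg (h0 x) (sq_nonneg _))
    (Eventually.of_forall fun a => integral_nonneg fun p => kerPos_nonneg (fun x => sq_nonneg _) p)
    (Eventually.of_forall fun a => integral_nonneg fun p => kerNeg_nonneg (fun x => sq_nonneg _) p)
    ?_ ?_ ?_ ?_
  · obtain ⟨k1, k2, k3, k4⟩ := hkey
    simp only [sq_epsOf]
    refine ⟨k1, k2, k3.congr' ?_, k4⟩
    filter_upwards [hIoo] with a ha
    obtain ⟨hu, hua⟩ := hmem a ha
    have hi := integrable_kerPos (ρ := fun x => ‖u a x‖ ^ 2)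
      (hu.1.1.continuous.norm.pow 2).measurable (fun x => sq_nonneg _) hu.1.2.1
      (hu.integrable_norm_sq_mul hΩ h0)
    congr 1
    exact integral_prod _ hi
  · filter_upwards [hIoo] with a ha
    obtain ⟨hu, hua⟩ := hmem a ha
    set F := ∫ x, ‖u a x‖ ^ 4
    set G := ∫ x, gradAbsSq (u a) x
    have hG0 : 0 ≤ G := integral_nonneg fun x => gradAbsSq_nonneg _ x
    have hlim : astar * F ≤ 2 * a * G := by
      have ht : Tendsto (fun a' : ℝ => a' * F) (𝓝[<] astar) (𝓝 (astar * F)) :=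
        (tendsto_id.mono_left nhdsWithin_le_nhds).mul_const F
      refine le_of_tendsto ht ?_
      filter_upwards [hIoo] with a' ha'
      have := hu.1.gagliardo_nirenberg_abs (a := a')
        (fun w hw => hw.gagliardo_nirenberg hV ha'.1 (hmin a' ha'))
      rwa [hua] at this
    have h1 : 2 * a * G ≤ astar * (2 * G) := by nlinarith [ha.2]
    exact le_of_mul_le_mul_left (hlim.trans h1) hM
  · filter_upwards [hIoo] with a ha r hr
    obtain ⟨hu, hua⟩ := hmem a ha
    have h := (integrable_kerNeg_and_le (ρ := fun x => ‖u a x‖ ^ 2)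
      (hu.1.1.continuous.norm.pow 2).measurable (fun x => sq_nonneg _) hu.1.2.1 (h4 a ha) hr).2
    simp only [hua, ← pow_mul] at h
    refine h.trans ?_
    have hκ : 0 ≤ ∫ z, singKernel z := integral_nonneg singKernel_nonneg
    have hF : 0 ≤ ∫ x, ‖u a x‖ ^ 4 := integral_nonneg fun x => by positivity
    have ha0 := ha.1.le
    refine mul_le_mul ha.2.le ?_ (by positivity) hM.le
    gcongr
    exact ha.2.le
  · filter_upwards [hIoo] with a ha
    rw [(hmin a ha).eInf_eq]
    exact (hmem a ha).1.energy_ge hΩ h0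
  · intro B
    have := hQ.eventually_energy_le hV Ω B
    rw [← hastar] at this
    filter_upwards [hIoo, this] with a ha h
    rw [(hmin a ha).eInf_eq]
    exact h _ (hmin a ha)

end
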